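/- arXiv:1404.0145 — 4 statements merged into one kernel-verified Lean document; each statement's English description precedes it below -/
import Mathlib

section
/- For any measures μ_1,…,μ_m ∈ 𝒰_p(ℝ) and weights w_1,…,w_m ≥ 0 with Σ_j w_j = 1, the functional η ↦ Σ_j w_j ℓ_p(η, μ_j)^p attains its infimum over 𝒰_p(ℝ), i.e. a Wasserstein barycenter exists. Moreover, if at least one μ_j with w_j > 0 assigns zero mass to every Borel set of Hausdorff dimension 0, then the minimizer is unique. -/
open MeasureTheory Filter Topology

noncomputable section

/-- The set of couplings (transport plans) between two Borel probability measures on ℝ. -/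
def Couplings (μ ν : Measure ℝ) : Set (Measure (ℝ × ℝ)) :=
  {γ | IsProbabilityMeasure γ ∧ γ.map Prod.fst = μ ∧ γ.map Prod.snd = ν}

/-- The `p`-Wasserstein distance `ℓ_p` between measures on ℝ. -/
def Wp (p : ℝ) (μ ν : Measure ℝ) : ℝ :=
  ((⨅ γ ∈ Couplings μ ν,
      ∫⁻ z : ℝ × ℝ, ENNReal.ofReal (|z.1 - z.2| ^ p) ∂γ) ^ (1 / p)).toReal

/-- Membership in `𝒰_p(ℝ)`: Borel probability measures on ℝ with finite `p`-th moment. -/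
def MemUp (p : ℝ) (μ : Measure ℝ) : Prop :=
  IsProbabilityMeasure μ ∧ (∫⁻ x : ℝ, ENNReal.ofReal (|x| ^ p) ∂μ) < ⊤

/-- `η` is a Wasserstein barycenter (a minimizer over `𝒰_p(ℝ)` of the weighted sum of
`p`-th powers of `p`-Wasserstein distances) of the family `μs` with weights `w`. -/
def IsBarycenter (p : ℝ) {m : ℕ} (w : Fin m → ℝ) (μs : Fin m → Measure ℝ)
    (η : Measure ℝ) : Prop :=
  MemUp p η ∧ ∀ χ : Measure ℝ, MemUp p χ →
    ∑ j, w j * Wp p η (μs j) ^ p ≤ ∑ j, w j * Wp p χ (μs j) ^ p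

/-- Valid consensus weights: entries in `[0,1]`, positivity pattern symmetric (undirected
network, neighbour `j ∈ 𝒩_i ↔ w i j > 0`), positive diagonal, rows summing to one. -/
def ValidWeights {n : ℕ} (w : Fin n → Fin n → ℝ) : Prop :=
  (∀ i j, w i j ∈ Set.Icc (0 : ℝ) 1) ∧ (∀ i j, 0 < w i j ↔ 0 < w j i) ∧
    (∀ i, 0 < w i i) ∧ (∀ i, ∑ j, w i j = 1)

/-- One step of the Wasserstein consensus protocol: each agent `i` moves to the unique
minimizer of `η ↦ ∑_j w i j * ℓ_p(η, μs j)^p` over `𝒰_p(ℝ)`. -/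
def ConsensusStep (p : ℝ) {n : ℕ} (w : Fin n → Fin n → ℝ) (μs μ' : Fin n → Measure ℝ) : Prop :=
  ∀ i, IsBarycenter p (w i) μs (μ' i) ∧ ∀ χ, IsBarycenter p (w i) μs χ → χ = μ' i

/-- The Wasserstein convex hull of a finite family of measures: the set of all their
Wasserstein barycenters over all weight vectors. -/
def WCoHull (p : ℝ) {m : ℕ} (μs : Fin m → Measure ℝ) : Set (Measure ℝ) :=
  {η | ∃ w : Fin m → ℝ, (∀ j, 0 ≤ w j) ∧ (∑ j, w j = 1) ∧ IsBarycenter p w μs η}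

/-- The Lyapunov-like quantity `ν`: the maximum over pairs of agents of the `p`-th power of
the `p`-Wasserstein distance between their states. -/
def maxWp (p : ℝ) {m : ℕ} (μs : Fin m → Measure ℝ) : ℝ :=
  ⨆ i : Fin m, ⨆ j : Fin m, Wp p (μs i) (μs j) ^ p

/-- The quantile function (generalized inverse cumulative distribution function) `F_μ⁺`. -/
def qf (μ : Measure ℝ) (u : ℝ) : ℝ :=
  sInf {x : ℝ | u ≤ (μ (Set.Iic x)).toReal}

namespace WB

/-- Lebesgue measure on the open unit interval. -/
def lam : Measure ℝ := volume.restrict (Set.Ioo 0 1)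

instance : IsProbabilityMeasure lam := ⟨by simp [lam]⟩

lemma exists_rep (μ : Measure ℝ) [IsProbabilityMeasure μ] :
    ∃ Q : ℝ → ℝ, Measurable Q ∧ MonotoneOn Q (Set.Ioo 0 1) ∧ lam.map Q = μ := by
  classical
  set F := ProbabilityTheory.cdf μ with hF
  have hF0 : ∀ x, 0 ≤ F x := ProbabilityTheory.cdf_nonneg μ
  have hF1 : ∀ x, F x ≤ 1 := ProbabilityTheory.cdf_le_one μ
  have hmono : Monotone F := ProbabilityTheory.monotone_cdf μ
  let q : ℝ → ℝ := fun u => sInf {x | u ≤ F x}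
  have hgal : ∀ u ∈ Set.Ioo (0:ℝ) 1, ∀ x, q u ≤ x ↔ u ≤ F x := by
    intro u hu x
    have hne : {x | u ≤ F x}.Nonempty := by
      obtain ⟨y, hy⟩ := ((ProbabilityTheory.tendsto_cdf_atTop μ).eventually
        (eventually_gt_nhds hu.2)).exists
      exact ⟨y, le_of_lt hy⟩
    have hbd : BddBelow {x | u ≤ F x} := by
      obtain ⟨y, hy⟩ := ((ProbabilityTheory.tendsto_cdf_atBot μ).eventually
        (eventually_lt_nhds hu.1)).exists
      refine ⟨y, fun z hz => ?_⟩
      by_contra! h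
      have := hmono h.le
      have hz' : u ≤ F z := hz
      have hy' : F y < u := hy
      linarith
    constructor
    · intro hx
      have hright : ContinuousWithinAt F (Set.Ioi x) x :=
        (F.right_continuous x).mono Set.Ioi_subset_Ici_self
      refine ge_of_tendsto hright ?_
      filter_upwards [self_mem_nhdsWithin] with y hy
      have : q u < y := lt_of_le_of_lt hx hy
      obtain ⟨z, hz, hzy⟩ := (csInf_lt_iff hbd hne).1 this
      exact le_trans hz (hmono hzy.le)
    · intro hx
      exact csInf_le hbd hx
  have hqm : MonotoneOn q (Set.Ioo 0 1) := by
    intro u hu v hv huv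
    rw [hgal u hu]
    exact huv.trans ((hgal v hv _).1 le_rfl)
  let Q : ℝ → ℝ := Set.indicator (Set.Ioo 0 1) q
  have hQq : ∀ u ∈ Set.Ioo (0:ℝ) 1, Q u = q u := fun u hu => Set.indicator_of_mem hu q
  have hQ : Measurable Q := by
    refine measurable_of_restrict_of_restrict_compl (s := Set.Ioo (0:ℝ) 1) measurableSet_Ioo ?_ ?_
    · have : Monotone ((Set.Ioo (0:ℝ) 1).domRestrict Q) := by
        intro x y hxy
        simp only [Set.domRestrict_apply, hQq _ x.2, hQq _ y.2]
        exact hqm x.2 y.2 hxy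
      exact this.measurable
    · have : (Set.Ioo (0:ℝ) 1)ᶜ.domRestrict Q = fun _ => 0 := by
        ext x
        exact Set.indicator_of_notMem x.2 q
      rw [this]; exact measurable_const
  refine ⟨Q, hQ, ?_, ?_⟩
  · intro u hu v hv huv
    rw [hQq u hu, hQq v hv]; exact hqm hu hv huv
  · have : IsProbabilityMeasure (lam.map Q) := Measure.isProbabilityMeasure_map hQ.aemeasurable
    refine Measure.ext_of_Iic _ _ fun x => ?_
    rw [Measure.map_apply hQ measurableSet_Iic, lam, Measure.restrict_apply (hQ measurableSet_Iic),
      ← ProbabilityTheory.ofReal_cdf]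
    have hset : Q ⁻¹' Set.Iic x ∩ Set.Ioo 0 1 = Set.Ioo 0 1 ∩ Set.Iic (F x) := by
      ext u
      simp only [Set.mem_inter_iff, Set.mem_preimage, Set.mem_Iic]
      constructor
      · rintro ⟨h1, h2⟩
        rw [hQq u h2, hgal u h2] at h1
        exact ⟨h2, h1⟩
      · rintro ⟨h1, h2⟩
        refine ⟨?_, h1⟩
        rw [hQq u h1, hgal u h1]
        exact h2
    rw [hset]
    apply le_antisymm
    · calc volume (Set.Ioo 0 1 ∩ Set.Iic (F x)) ≤ volume (Set.Ioc 0 (F x)) :=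
            measure_mono fun u (hu : u ∈ Set.Ioo 0 1 ∩ Set.Iic (F x)) => Set.mem_Ioc.2 ⟨hu.1.1, hu.2⟩
        _ = _ := by simp [hF]
    · calc ENNReal.ofReal (F x) = volume (Set.Ioo 0 (F x)) := by simp
        _ ≤ _ := measure_mono fun u (hu : u ∈ Set.Ioo 0 (F x)) =>
            Set.mem_inter (Set.mem_Ioo.2 ⟨hu.1, hu.2.trans_le (hF1 x)⟩) (Set.mem_Iic.2 hu.2.le)

lemma nested {X Y : ℝ → ℝ} (hX : Measurable X) (hY : Measurable Y)
    (mX : MonotoneOn X (Set.Ioo 0 1)) (mY : MonotoneOn Y (Set.Ioo 0 1))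
    (γ : Measure (ℝ × ℝ)) [IsProbabilityMeasure γ]
    (h1 : γ.map Prod.fst = lam.map X) (h2 : γ.map Prod.snd = lam.map Y) (s t : ℝ) :
    lam {u | Y u ≤ s ∧ t ≤ X u} ≤ γ {z | z.2 ≤ s ∧ t ≤ z.1} := by
  have hA : lam {u | Y u ≤ s} = γ {z | z.2 ≤ s} := by
    have := congrArg (fun m => m (Set.Iic s)) h2
    simp only [Measure.map_apply measurable_snd measurableSet_Iic,
      Measure.map_apply hY measurableSet_Iic] at this
    exact this.symm
  have hB : lam {u | X u < t} = γ {z | z.1 < t} := by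
    have := congrArg (fun m => m (Set.Iio t)) h1
    simp only [Measure.map_apply measurable_fst measurableSet_Iio,
      Measure.map_apply hX measurableSet_Iio] at this
    exact this.symm
  have hae : ∀ᵐ u ∂lam, u ∈ Set.Ioo (0:ℝ) 1 := ae_restrict_mem measurableSet_Ioo
  have hd : {z : ℝ × ℝ | z.2 ≤ s ∧ t ≤ z.1} = {z | z.2 ≤ s} \ {z | z.1 < t} := by
    ext z; simp
  have hd' : {u | Y u ≤ s ∧ t ≤ X u} = {u | Y u ≤ s} \ {u | X u < t} := by
    ext z; simp
  by_cases hc : ∃ u ∈ Set.Ioo (0:ℝ) 1, Y u ≤ s ∧ t ≤ X u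
  · obtain ⟨u, hu, hus, hut⟩ := hc
    have hsub : {v | X v < t} ≤ᵐ[lam] {v | Y v ≤ s} := by
      filter_upwards [hae] with v hv hvt
      have hvt' : X v < t := hvt
      have : v ≤ u := by
        by_contra! h
        have := mX hu hv h.le
        linarith
      exact (mY hv hu this).trans hus
    rw [hd, hd', measure_sdiff' _ (measurableSet_lt hX measurable_const).nullMeasurableSet
      (measure_ne_top _ _)]
    have : lam ({u | Y u ≤ s} ∪ {u | X u < t}) = lam {u | Y u ≤ s} := by
      apply measure_congr
      exact union_ae_eq_left_iff_ae_subset.2 hsub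
    rw [this, hA, hB]
    exact le_measure_sdiff
  · push Not at hc
    have : lam {u | Y u ≤ s ∧ t ≤ X u} = 0 := by
      rw [measure_eq_zero_iff_ae_notMem]
      filter_upwards [hae] with v hv hvt
      exact absurd hvt.2 (not_le.2 (hc v hv hvt.1))
    rw [this]; exact zero_le

/-- the kernel -/
def J (p : ℝ) (s : ℝ × ℝ) : ENNReal :=
  Set.indicator {s : ℝ × ℝ | s.1 ≤ s.2}
    (fun s => ENNReal.ofReal (p * (p - 1) * (s.2 - s.1) ^ (p - 2))) s

lemma measurable_J (p : ℝ) : Measurable (J p) := by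
  unfold J
  refine Measurable.indicator ?_ (measurableSet_le measurable_fst measurable_snd)
  fun_prop

lemma lint_rpow {r a b : ℝ} (hr : 0 ≤ r) (hab : a ≤ b) (c : ℝ) (hc : 0 ≤ c) :
    ∫⁻ t in Set.Icc a b, ENNReal.ofReal (c * (t - a) ^ r) =
      ENNReal.ofReal (c * ((b - a) ^ (r + 1) / (r + 1))) := by
  have hcont : Continuous fun t : ℝ => c * (t - a) ^ r :=
    continuous_const.mul ((continuous_id.sub continuous_const).rpow_const fun _ => Or.inr hr)
  rw [← ofReal_integral_eq_lintegral_ofReal (hcont.integrableOn_Icc)]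
  · congr 1
    rw [integral_Icc_eq_integral_Ioc, ← intervalIntegral.integral_of_le hab,
      intervalIntegral.integral_const_mul,
      intervalIntegral.integral_comp_sub_right (fun t => t ^ r) a,
      integral_rpow (Or.inl (by linarith)), sub_self, Real.zero_rpow (by linarith), sub_zero]
  · filter_upwards [ae_restrict_mem measurableSet_Icc] with t ht
    exact mul_nonneg hc (Real.rpow_nonneg (by linarith [ht.1]) _)

lemma lint_rpow' {r a b : ℝ} (hr : 0 ≤ r) (hab : a ≤ b) (c : ℝ) (hc : 0 ≤ c) :
    ∫⁻ t in Set.Icc a b, ENNReal.ofReal (c * (b - t) ^ r) =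
      ENNReal.ofReal (c * ((b - a) ^ (r + 1) / (r + 1))) := by
  have hcont : Continuous fun t : ℝ => c * (b - t) ^ r :=
    continuous_const.mul ((continuous_const.sub continuous_id).rpow_const fun _ => Or.inr hr)
  rw [← ofReal_integral_eq_lintegral_ofReal (hcont.integrableOn_Icc)]
  · congr 1
    rw [integral_Icc_eq_integral_Ioc, ← intervalIntegral.integral_of_le hab,
      intervalIntegral.integral_const_mul,
      intervalIntegral.integral_comp_sub_left (fun t => t ^ r) b,
      integral_rpow (Or.inl (by linarith)), sub_self, Real.zero_rpow (by linarith), sub_zero]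
  · filter_upwards [ae_restrict_mem measurableSet_Icc] with t ht
    exact mul_nonneg hc (Real.rpow_nonneg (by linarith [ht.2]) _)

/-- one-sided layers -/
def S (x y : ℝ) : Set (ℝ × ℝ) := {s | y ≤ s.1 ∧ s.2 ≤ x}

lemma measurableSet_S (x y : ℝ) : MeasurableSet (S x y) :=
  (measurableSet_le measurable_const measurable_fst).inter
    (measurableSet_le measurable_snd measurable_const)

lemma layer {p : ℝ} (hp : 2 ≤ p) (x y : ℝ) :
    ∫⁻ s, (S x y).indicator (J p) s = ENNReal.ofReal ((max (x - y) 0) ^ p) := by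
  rw [Measure.volume_eq_prod, lintegral_prod _
    ((measurable_J p).indicator (measurableSet_S x y)).aemeasurable]
  have hin : ∀ s, ∫⁻ t, (S x y).indicator (J p) (s, t) =
      (Set.Icc y x).indicator (fun s => ENNReal.ofReal (p * (x - s) ^ (p - 1))) s := by
    intro s
    by_cases hs : s ∈ Set.Icc y x
    · rw [Set.indicator_of_mem hs]
      have : ∀ t, (S x y).indicator (J p) (s, t) = (Set.Icc s x).indicator
          (fun t => ENNReal.ofReal (p * (p - 1) * (t - s) ^ (p - 2))) t := by
        intro t
        simp only [Set.indicator, S, J, Set.mem_ofPred_eq, Set.mem_Icc]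
        have := hs.1
        by_cases h1 : s ≤ t <;> by_cases h2 : t ≤ x <;> simp [h1, h2, this]
      simp_rw [this]
      rw [lintegral_indicator measurableSet_Icc,
        lint_rpow (by linarith) hs.2 _ (mul_nonneg (by linarith) (by linarith))]
      congr 1
      have : p - 2 + 1 = p - 1 := by ring
      rw [this]
      have : p - 1 ≠ 0 := by linarith
      field_simp
    · rw [Set.indicator_of_notMem hs]
      have : ∀ t, (S x y).indicator (J p) (s, t) = 0 := by
        intro t
        simp only [Set.indicator, S, J, Set.mem_ofPred_eq]
        split_ifs with h1 h2
        · exact absurd ⟨h1.1, h2.trans h1.2⟩ hs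
        · rfl
        · rfl
      simp [this]
  simp_rw [hin]
  rw [lintegral_indicator measurableSet_Icc]
  rcases le_or_gt y x with h | h
  · rw [lint_rpow' (by linarith) h _ (by linarith), max_eq_left (by linarith)]
    congr 1
    have : p - 1 + 1 = p := by ring
    rw [this]
    have : p ≠ 0 := by linarith
    field_simp
  · rw [Set.Icc_eq_empty (not_le.2 h), max_eq_right (by linarith), Real.zero_rpow (by linarith)]
    simp

lemma layer_abs {p : ℝ} (hp : 2 ≤ p) (x y : ℝ) :
    ENNReal.ofReal (|x - y| ^ p) =
      ∫⁻ s, (S x y).indicator (J p) s + (S y x).indicator (J p) s := by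
  rw [lintegral_add_left ((measurable_J p).indicator (measurableSet_S x y)), layer hp, layer hp]
  have h0 : (0:ℝ) ^ p = 0 := Real.zero_rpow (by linarith)
  rcases le_total y x with h | h
  · rw [max_eq_left (by linarith), max_eq_right (by linarith), h0, abs_of_nonneg (by linarith)]
    simp
  · rw [max_eq_right (by linarith), max_eq_left (by linarith), h0, abs_of_nonpos (by linarith)]
    simp

lemma mset {α : Type*} [MeasurableSpace α] {f g f' g' : α → ℝ} (h1 : Measurable f)
    (h2 : Measurable g) (h3 : Measurable f') (h4 : Measurable g') :
    MeasurableSet {a | f a ≤ g a ∧ f' a ≤ g' a} :=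
  (measurableSet_le h1 h2).inter (measurableSet_le h3 h4)

lemma cost_formula {p : ℝ} (hp : 2 ≤ p) (γ : Measure (ℝ × ℝ)) [IsProbabilityMeasure γ] :
    ∫⁻ z, ENNReal.ofReal (|z.1 - z.2| ^ p) ∂γ =
      ∫⁻ s : ℝ × ℝ, J p s * (γ {z | z.2 ≤ s.1 ∧ s.2 ≤ z.1} + γ {z | z.1 ≤ s.1 ∧ s.2 ≤ z.2}) := by
  simp_rw [layer_abs hp]
  have m1 : MeasurableSet {q : (ℝ × ℝ) × (ℝ × ℝ) | q.1.2 ≤ q.2.1 ∧ q.2.2 ≤ q.1.1} := by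
    apply mset <;> fun_prop
  have m2 : MeasurableSet {q : (ℝ × ℝ) × (ℝ × ℝ) | q.1.1 ≤ q.2.1 ∧ q.2.2 ≤ q.1.2} := by
    apply mset <;> fun_prop
  have mJ : Measurable (fun q : (ℝ × ℝ) × (ℝ × ℝ) => J p q.2) := (measurable_J p).comp measurable_snd
  rw [lintegral_lintegral_swap]
  · refine lintegral_congr fun s => ?_
    have e1 : ∀ z : ℝ × ℝ, (S z.1 z.2).indicator (J p) s =
        {z : ℝ × ℝ | z.2 ≤ s.1 ∧ s.2 ≤ z.1}.indicator (fun _ => J p s) z := by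
      intro z
      by_cases h : z.2 ≤ s.1 ∧ s.2 ≤ z.1 <;> simp [Set.indicator, S, h]
    have e2 : ∀ z : ℝ × ℝ, (S z.2 z.1).indicator (J p) s =
        {z : ℝ × ℝ | z.1 ≤ s.1 ∧ s.2 ≤ z.2}.indicator (fun _ => J p s) z := by
      intro z
      by_cases h : z.1 ≤ s.1 ∧ s.2 ≤ z.2 <;> simp [Set.indicator, S, h]
    have n1 : MeasurableSet {z : ℝ × ℝ | z.2 ≤ s.1 ∧ s.2 ≤ z.1} := by
      apply mset <;> fun_prop
    have n2 : MeasurableSet {z : ℝ × ℝ | z.1 ≤ s.1 ∧ s.2 ≤ z.2} := by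
      apply mset <;> fun_prop
    simp_rw [e1, e2]
    rw [lintegral_add_left (measurable_const.indicator n1), lintegral_indicator_const n1,
      lintegral_indicator_const n2, mul_add]
  · refine Measurable.aemeasurable ?_
    convert (mJ.indicator m1).add (mJ.indicator m2) using 1
    ext ⟨z, s⟩
    by_cases h : z.2 ≤ s.1 ∧ s.2 ≤ z.1 <;> by_cases h' : z.1 ≤ s.1 ∧ s.2 ≤ z.2 <;>
      simp [Set.indicator, S, h, h']

/-- optimality of the monotone coupling -/
lemma monotone_opt {p : ℝ} (hp : 2 ≤ p) {X Y : ℝ → ℝ} (hX : Measurable X) (hY : Measurable Y)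
    (mX : MonotoneOn X (Set.Ioo 0 1)) (mY : MonotoneOn Y (Set.Ioo 0 1))
    (γ : Measure (ℝ × ℝ)) [IsProbabilityMeasure γ]
    (h1 : γ.map Prod.fst = lam.map X) (h2 : γ.map Prod.snd = lam.map Y) :
    ∫⁻ u, ENNReal.ofReal (|X u - Y u| ^ p) ∂lam ≤ ∫⁻ z, ENNReal.ofReal (|z.1 - z.2| ^ p) ∂γ := by
  have hXY : Measurable fun u => (X u, Y u) := hX.prodMk hY
  have : IsProbabilityMeasure (lam.map fun u => (X u, Y u)) :=
    Measure.isProbabilityMeasure_map hXY.aemeasurable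
  have hmap : ∫⁻ u, ENNReal.ofReal (|X u - Y u| ^ p) ∂lam =
      ∫⁻ z, ENNReal.ofReal (|z.1 - z.2| ^ p) ∂(lam.map fun u => (X u, Y u)) := by
    rw [lintegral_map (by fun_prop) hXY]
  rw [hmap, cost_formula hp, cost_formula hp]
  refine lintegral_mono fun s => ?_
  have n1 : MeasurableSet {z : ℝ × ℝ | z.2 ≤ s.1 ∧ s.2 ≤ z.1} := by
    apply mset <;> fun_prop
  have n2 : MeasurableSet {z : ℝ × ℝ | z.1 ≤ s.1 ∧ s.2 ≤ z.2} := by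
    apply mset <;> fun_prop
  rw [Measure.map_apply hXY n1, Measure.map_apply hXY n2]
  gcongr
  · exact nested hX hY mX mY γ h1 h2 s.1 s.2
  · let γ' := γ.map Prod.swap
    have : IsProbabilityMeasure γ' := Measure.isProbabilityMeasure_map (by fun_prop)
    have g1 : γ'.map Prod.fst = lam.map Y := by
      rw [Measure.map_map measurable_fst measurable_swap, ← h2]; rfl
    have g2 : γ'.map Prod.snd = lam.map X := by
      rw [Measure.map_map measurable_snd measurable_swap, ← h1]; rfl
    have := nested hY hX mY mX γ' g1 g2 s.1 s.2
    rwa [Measure.map_apply measurable_swap n1] at this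

lemma abs_rpow_strictConvex {p : ℝ} (hp : 2 ≤ p) :
    StrictConvexOn ℝ Set.univ (fun x : ℝ => |x| ^ p) := by
  refine ⟨convex_univ, fun x _ y _ hxy a b ha hb hab => ?_⟩
  have hconv := strictConvexOn_rpow (show 1 < p by linarith)
  simp only [smul_eq_mul]
  have habs : |a * x + b * y| ≤ a * |x| + b * |y| := by
    calc |a * x + b * y| ≤ |a * x| + |b * y| := abs_add_le _ _
      _ = _ := by rw [abs_mul, abs_mul, abs_of_pos ha, abs_of_pos hb]
  by_cases h : |x| = |y|
  · have hlt : |a * x + b * y| < |y| := by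
      have hxy' : x = -y := by
        rcases abs_eq_abs.1 h with h | h
        · exact absurd h hxy
        · exact h
      have hy : y ≠ 0 := by
        rintro rfl; simp at hxy'; exact hxy hxy'
      have : a * x + b * y = (b - a) * y := by rw [hxy']; ring
      rw [this, abs_mul]
      have h1 : |b - a| < 1 := by rw [abs_lt]; constructor <;> linarith
      have h2 : 0 < |y| := abs_pos.2 hy
      nlinarith
    calc |a * x + b * y| ^ p < |y| ^ p := Real.rpow_lt_rpow (abs_nonneg _) hlt (by linarith)
      _ = (a + b) * |y| ^ p := by rw [hab, one_mul]
      _ = _ := by rw [h]; ring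
  · calc |a * x + b * y| ^ p ≤ (a * |x| + b * |y|) ^ p :=
          Real.rpow_le_rpow (abs_nonneg _) habs (by linarith)
      _ < _ := by
          have := hconv.2 (Set.mem_Ici.2 (abs_nonneg x)) (Set.mem_Ici.2 (abs_nonneg y)) h ha hb hab
          simpa using this

/-- pointwise objective -/
def obj (p : ℝ) {m : ℕ} (w a : Fin m → ℝ) (x : ℝ) : ℝ := ∑ j, w j * |x - a j| ^ p

lemma obj_continuous {p : ℝ} (hp : 2 ≤ p) {m : ℕ} (w a : Fin m → ℝ) : Continuous (obj p w a) := by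
  unfold obj
  refine continuous_finsetSum _ fun j _ => continuous_const.mul ?_
  exact ((continuous_id.sub continuous_const).abs).rpow_const fun _ => Or.inr (by linarith)

lemma obj_strict {p : ℝ} (hp : 2 ≤ p) {m : ℕ} (w a : Fin m → ℝ) (hw : ∀ j, 0 ≤ w j)
    (hj : ∃ j, 0 < w j) {x y : ℝ} (hxy : x ≠ y) {s t : ℝ} (hs : 0 < s) (ht : 0 < t)
    (hst : s + t = 1) : obj p w a (s * x + t * y) < s * obj p w a x + t * obj p w a y := by
  have key : ∀ j, |s * x + t * y - a j| ^ p < s * |x - a j| ^ p + t * |y - a j| ^ p := by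
    intro j
    have := (abs_rpow_strictConvex hp).2 (Set.mem_univ (x - a j)) (Set.mem_univ (y - a j))
      (fun h => hxy (by linarith)) hs ht hst
    simp only [smul_eq_mul] at this
    have e : s * x + t * y - a j = s * (x - a j) + t * (y - a j) := by
      linear_combination (a j) * hst
    rw [e]; exact this
  unfold obj
  rw [Finset.mul_sum, Finset.mul_sum, ← Finset.sum_add_distrib]
  obtain ⟨j, hj⟩ := hj
  refine Finset.sum_lt_sum (fun i _ => ?_) ⟨j, Finset.mem_univ j, ?_⟩
  · nlinarith [mul_le_mul_of_nonneg_left (key i).le (hw i)]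
  · nlinarith [mul_lt_mul_of_pos_left (key j) hj]

lemma obj_ge {p : ℝ} {m : ℕ} (w a : Fin m → ℝ) (hw : ∀ j, 0 ≤ w j) (j : Fin m) (x : ℝ) :
    w j * |x - a j| ^ p ≤ obj p w a x := by
  unfold obj
  exact Finset.single_le_sum (f := fun j => w j * |x - a j| ^ p)
    (fun i _ => mul_nonneg (hw i) (Real.rpow_nonneg (abs_nonneg _) _)) (Finset.mem_univ j)

lemma obj_argmin {p : ℝ} (hp : 2 ≤ p) {m : ℕ} (w a : Fin m → ℝ) (hw : ∀ j, 0 ≤ w j)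
    (hj : ∃ j, 0 < w j) : ∃ b, ∀ y, obj p w a b ≤ obj p w a y := by
  refine (obj_continuous hp w a).exists_forall_le ?_
  obtain ⟨j, hj⟩ := hj
  refine tendsto_atTop_mono (obj_ge w a hw j) ?_
  refine Tendsto.const_mul_atTop hj ?_
  refine (tendsto_rpow_atTop (by linarith)).comp ?_
  have h1 : Tendsto (fun x : ℝ => |x| - |a j|) (cocompact ℝ) atTop :=
    tendsto_atTop_add_const_right _ _ (tendsto_norm_cocompact_atTop (E := ℝ))
  exact tendsto_atTop_mono (fun x => abs_sub_abs_le_abs_sub _ _) h1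

lemma obj_unique {p : ℝ} (hp : 2 ≤ p) {m : ℕ} (w a : Fin m → ℝ) (hw : ∀ j, 0 ≤ w j)
    (hj : ∃ j, 0 < w j) {b : ℝ} (hb : ∀ y, obj p w a b ≤ obj p w a y) {y : ℝ}
    (hy : obj p w a y ≤ obj p w a b) : y = b := by
  by_contra hne
  have h := obj_strict hp w a hw hj hne (s := 1/2) (t := 1/2) (by norm_num) (by norm_num)
    (by norm_num)
  have := hb (1/2 * y + 1/2 * b)
  linarith

lemma obj_lt_iff {p : ℝ} (hp : 2 ≤ p) {m : ℕ} (w a : Fin m → ℝ) (hw : ∀ j, 0 ≤ w j)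
    (hj : ∃ j, 0 < w j) {b : ℝ} (hb : ∀ y, obj p w a b ≤ obj p w a y) (x : ℝ) :
    b < x ↔ ∃ r : ℚ, (r : ℝ) < x ∧ obj p w a r < obj p w a x := by
  constructor
  · intro h
    obtain ⟨r, hr1, hr2⟩ := exists_rat_btwn h
    refine ⟨r, hr2, ?_⟩
    have hd : 0 < x - b := by linarith
    have := obj_strict hp w a hw hj h.ne (s := (x - r) / (x - b)) (t := (r - b) / (x - b))
      (div_pos (by linarith) hd) (div_pos (by linarith) hd) (by field_simp; ring)
    have e : (x - r) / (x - b) * b + (r - b) / (x - b) * x = r := by field_simp; ring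
    rw [e] at this
    have hb' := mul_le_mul_of_nonneg_left (hb x) (div_pos (show 0 < x - r by linarith) hd).le
    have hs : (x - r) / (x - b) + (r - b) / (x - b) = 1 := by field_simp; ring
    calc _ < _ := this
      _ ≤ ((x - r) / (x - b) + (r - b) / (x - b)) * obj p w a x := by rw [add_mul]; linarith
      _ = _ := by rw [hs, one_mul]
  · rintro ⟨r, hr, hlt⟩
    by_contra! hxb
    rcases hxb.eq_or_lt with h | h
    · rw [h] at hlt; exact absurd (hb r) (not_le.2 hlt)
    have hd : 0 < b - r := by linarith
    have := obj_strict hp w a hw hj (show (r:ℝ) ≠ b by linarith) (s := (b - x) / (b - r))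
      (t := (x - r) / (b - r))
      (div_pos (by linarith) hd) (div_pos (by linarith) hd) (by field_simp; ring)
    have e : (b - x) / (b - r) * r + (x - r) / (b - r) * b = x := by field_simp; ring
    rw [e] at this
    have hb' := mul_le_mul_of_nonneg_left (hb r) (div_pos (show 0 < x - r by linarith) hd).le
    have hs : (b - x) / (b - r) + (x - r) / (b - r) = 1 := by field_simp; ring
    have : obj p w a x < ((b - x) / (b - r) + (x - r) / (b - r)) * obj p w a r := by
      rw [add_mul]; linarith
    rw [hs, one_mul] at this
    linarith

lemma exists_argmin_fun {p : ℝ} (hp : 2 ≤ p) {m : ℕ} (w : Fin m → ℝ) (hw : ∀ j, 0 ≤ w j)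
    (hj : ∃ j, 0 < w j) (Q : Fin m → ℝ → ℝ) (hQ : ∀ j, Measurable (Q j)) :
    ∃ B : ℝ → ℝ, Measurable B ∧
      ∀ u y, obj p w (fun j => Q j u) (B u) ≤ obj p w (fun j => Q j u) y := by
  choose B hB using fun u => obj_argmin hp w (fun j => Q j u) hw hj
  refine ⟨B, measurable_of_Iio fun x => ?_, hB⟩
  have : B ⁻¹' Set.Iio x = ⋃ r : ℚ, {u | (r : ℝ) < x ∧
      obj p w (fun j => Q j u) r < obj p w (fun j => Q j u) x} := by
    ext u
    simp only [Set.mem_preimage, Set.mem_Iio, Set.mem_iUnion, Set.mem_ofPred_eq]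
    exact obj_lt_iff hp w _ hw hj (hB u) x
  rw [this]
  have hm : ∀ y, Measurable fun u => obj p w (fun j => Q j u) y := by
    intro y
    unfold obj
    fun_prop
  exact MeasurableSet.iUnion fun r => (MeasurableSet.const _).inter (measurableSet_lt (hm _) (hm _))

lemma abs_add_rpow {p : ℝ} (hp : 2 ≤ p) (x y : ℝ) :
    |x + y| ^ p ≤ 2 ^ p * (|x| ^ p + |y| ^ p) := by
  have hx := Real.rpow_nonneg (abs_nonneg x) p
  have hy := Real.rpow_nonneg (abs_nonneg y) p
  have h2 : (0:ℝ) ≤ 2 ^ p := Real.rpow_nonneg (by norm_num) p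
  have h : |x + y| ≤ 2 * max |x| |y| := by
    have := abs_add_le x y
    have := le_max_left |x| |y|
    have := le_max_right |x| |y|
    linarith
  calc |x + y| ^ p ≤ (2 * max |x| |y|) ^ p := Real.rpow_le_rpow (abs_nonneg _) h (by linarith)
    _ = 2 ^ p * (max |x| |y|) ^ p :=
      Real.mul_rpow (by norm_num) (le_max_of_le_left (abs_nonneg _))
    _ ≤ _ := by
      refine mul_le_mul_of_nonneg_left ?_ h2
      rcases max_choice |x| |y| with h | h <;> rw [h] <;> linarith

lemma memUp_iff {p : ℝ} {X : ℝ → ℝ} (hX : Measurable X) :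
    MemUp p (lam.map X) ↔ Integrable (fun u => |X u| ^ p) lam := by
  have hpr : IsProbabilityMeasure (lam.map X) := Measure.isProbabilityMeasure_map hX.aemeasurable
  have hm : Measurable fun u => |X u| ^ p := by fun_prop
  unfold MemUp
  rw [lintegral_map (by fun_prop) hX]
  constructor
  · rintro ⟨_, h⟩
    exact ⟨hm.aestronglyMeasurable,
      (hasFiniteIntegral_iff_ofReal (ae_of_all _ fun u => Real.rpow_nonneg (abs_nonneg _) _)).2 h⟩
  · intro h
    exact ⟨hpr, (hasFiniteIntegral_iff_ofReal
      (ae_of_all _ fun u => Real.rpow_nonneg (abs_nonneg _) _)).1 h.2⟩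

lemma integrable_sub {p : ℝ} (hp : 2 ≤ p) {X Y : ℝ → ℝ} (hX : Measurable X) (hY : Measurable Y)
    (iX : Integrable (fun u => |X u| ^ p) lam) (iY : Integrable (fun u => |Y u| ^ p) lam) :
    Integrable (fun u => |X u - Y u| ^ p) lam := by
  refine ((iX.add iY).const_mul (2 ^ p)).mono'
          (Measurable.aestronglyMeasurable (by fun_prop)) (ae_of_all _ fun u => ?_)
  rw [Real.norm_of_nonneg (Real.rpow_nonneg (abs_nonneg _) _)]
  have := abs_add_rpow hp (X u) (-(Y u))
  rw [abs_neg] at this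
  simpa [sub_eq_add_neg] using this

lemma Wp_rpow {p : ℝ} (hp : 2 ≤ p) (μ ν : Measure ℝ) :
    Wp p μ ν ^ p = (⨅ γ ∈ Couplings μ ν,
      ∫⁻ z : ℝ × ℝ, ENNReal.ofReal (|z.1 - z.2| ^ p) ∂γ).toReal := by
  unfold Wp
  rw [ENNReal.toReal_rpow, ← ENNReal.rpow_mul, one_div_mul_cancel (by linarith), ENNReal.rpow_one]

lemma inf_le {p : ℝ} {X Y : ℝ → ℝ} (hX : Measurable X) (hY : Measurable Y) :
    (⨅ γ ∈ Couplings (lam.map X) (lam.map Y),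
      ∫⁻ z : ℝ × ℝ, ENNReal.ofReal (|z.1 - z.2| ^ p) ∂γ) ≤
      ∫⁻ u, ENNReal.ofReal (|X u - Y u| ^ p) ∂lam := by
  have hXY : Measurable fun u => (X u, Y u) := hX.prodMk hY
  have hmap : ∫⁻ u, ENNReal.ofReal (|X u - Y u| ^ p) ∂lam =
      ∫⁻ z, ENNReal.ofReal (|z.1 - z.2| ^ p) ∂(lam.map fun u => (X u, Y u)) := by
    rw [lintegral_map (by fun_prop) hXY]
  rw [hmap]
  refine iInf₂_le _ ⟨Measure.isProbabilityMeasure_map hXY.aemeasurable, ?_, ?_⟩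
  · rw [Measure.map_map measurable_fst hXY]; rfl
  · rw [Measure.map_map measurable_snd hXY]; rfl

lemma Wp_le {p : ℝ} (hp : 2 ≤ p) {X Y : ℝ → ℝ} (hX : Measurable X) (hY : Measurable Y)
    (hi : Integrable (fun u => |X u - Y u| ^ p) lam) :
    Wp p (lam.map X) (lam.map Y) ^ p ≤ ∫ u, |X u - Y u| ^ p ∂lam := by
  have hn : 0 ≤ᵐ[lam] fun u => |X u - Y u| ^ p :=
    ae_of_all _ fun u => Real.rpow_nonneg (abs_nonneg _) _
  rw [Wp_rpow hp, integral_eq_lintegral_of_nonneg_ae hn hi.1]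
  exact ENNReal.toReal_mono ((hasFiniteIntegral_iff_ofReal hn).1 hi.2).ne (inf_le hX hY)

lemma le_Wp {p : ℝ} (hp : 2 ≤ p) {X Y : ℝ → ℝ} (hX : Measurable X) (hY : Measurable Y)
    (mX : MonotoneOn X (Set.Ioo 0 1)) (mY : MonotoneOn Y (Set.Ioo 0 1))
    (hi : Integrable (fun u => |X u - Y u| ^ p) lam) :
    ∫ u, |X u - Y u| ^ p ∂lam ≤ Wp p (lam.map X) (lam.map Y) ^ p := by
  have hn : 0 ≤ᵐ[lam] fun u => |X u - Y u| ^ p :=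
    ae_of_all _ fun u => Real.rpow_nonneg (abs_nonneg _) _
  rw [Wp_rpow hp, integral_eq_lintegral_of_nonneg_ae hn hi.1]
  refine ENNReal.toReal_mono
    ((inf_le hX hY).trans_lt ((hasFiniteIntegral_iff_ofReal hn).1 hi.2)).ne ?_
  refine le_iInf₂ fun γ hγ => ?_
  have := hγ.1
  exact monotone_opt hp hX hY mX mY γ hγ.2.1 hγ.2.2

theorem main {p : ℝ} (hp : 2 ≤ p) {m : ℕ} (μs : Fin m → Measure ℝ) (hμs : ∀ j, MemUp p (μs j))
    (w : Fin m → ℝ) (hw : ∀ j, 0 ≤ w j) (hsum : ∑ j, w j = 1) :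
    ∃! η : Measure ℝ, IsBarycenter p w μs η := by
  have hj : ∃ j, 0 < w j := by
    by_contra! h
    have : ∑ j, w j ≤ 0 := Finset.sum_nonpos fun j _ => h j
    linarith
  have hrep : ∀ j, ∃ Q : ℝ → ℝ, Measurable Q ∧ MonotoneOn Q (Set.Ioo 0 1) ∧ lam.map Q = μs j :=
    fun j => by
      have := (hμs j).1
      exact exists_rep (μs j)
  choose Q hQ mQ eQ using hrep
  have iQ : ∀ j, Integrable (fun u => |Q j u| ^ p) lam := fun j => by
    rw [← memUp_iff (hQ j), eQ j]; exact hμs j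
  obtain ⟨B, hB, hmin⟩ := exists_argmin_fun hp w hw hj Q hQ
  have iB : Integrable (fun u => |B u| ^ p) lam := by
    obtain ⟨j, hj⟩ := hj
    have i0 : Integrable (fun u => obj p w (fun j => Q j u) 0) lam := by
      unfold obj
      simp only [zero_sub, abs_neg]
      exact integrable_finsetSum _ fun i _ => (iQ i).const_mul _
    have iBQ : Integrable (fun u => |B u - Q j u| ^ p) lam := by
      refine (i0.const_mul (w j)⁻¹).mono'
          (Measurable.aestronglyMeasurable (by fun_prop)) (ae_of_all _ fun u => ?_)
      rw [Real.norm_of_nonneg (Real.rpow_nonneg (abs_nonneg _) _)]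
      have h1 := obj_ge (p := p) w (fun j => Q j u) hw j (B u)
      have h2 := hmin u 0
      rw [inv_mul_eq_div, le_div_iff₀ hj]
      linarith
    refine ((iBQ.add (iQ j)).const_mul (2 ^ p)).mono'
          (Measurable.aestronglyMeasurable (by fun_prop)) (ae_of_all _ fun u => ?_)
    rw [Real.norm_of_nonneg (Real.rpow_nonneg (abs_nonneg _) _)]
    have := abs_add_rpow hp (B u - Q j u) (Q j u)
    simpa using this
  have iobj : ∀ X : ℝ → ℝ, Measurable X → Integrable (fun u => |X u| ^ p) lam →
      Integrable (fun u => obj p w (fun j => Q j u) (X u)) lam := by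
    intro X hX iX
    unfold obj
    exact integrable_finsetSum _ fun i _ => (integrable_sub hp hX (hQ i) iX (iQ i)).const_mul _
  have eobj : ∀ X : ℝ → ℝ, Measurable X → Integrable (fun u => |X u| ^ p) lam →
      ∫ u, obj p w (fun j => Q j u) (X u) ∂lam = ∑ j, w j * ∫ u, |X u - Q j u| ^ p ∂lam := by
    intro X hX iX
    unfold obj
    rw [integral_finsetSum _ fun i _ => (integrable_sub hp hX (hQ i) iX (iQ i)).const_mul _]
    simp_rw [integral_const_mul]
  have mB : MemUp p (lam.map B) := (memUp_iff hB).2 iB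
  have hle : ∑ j, w j * Wp p (lam.map B) (μs j) ^ p ≤
      ∫ u, obj p w (fun j => Q j u) (B u) ∂lam := by
    rw [eobj B hB iB]
    refine Finset.sum_le_sum fun j _ => mul_le_mul_of_nonneg_left ?_ (hw j)
    rw [← eQ j]
    exact Wp_le hp hB (hQ j) (integrable_sub hp hB (hQ j) iB (iQ j))
  have hge : ∀ X : ℝ → ℝ, Measurable X → MonotoneOn X (Set.Ioo 0 1) →
      Integrable (fun u => |X u| ^ p) lam →
      ∫ u, obj p w (fun j => Q j u) (X u) ∂lam ≤ ∑ j, w j * Wp p (lam.map X) (μs j) ^ p := by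
    intro X hX mX iX
    rw [eobj X hX iX]
    refine Finset.sum_le_sum fun j _ => mul_le_mul_of_nonneg_left ?_ (hw j)
    rw [← eQ j]
    exact le_Wp hp hX (hQ j) mX (mQ j) (integrable_sub hp hX (hQ j) iX (iQ j))
  refine ⟨lam.map B, ⟨mB, fun χ hχ => ?_⟩, fun χ hχ => ?_⟩
  · have := hχ.1
    obtain ⟨X, hX, mX, rfl⟩ := exists_rep χ
    have iX := (memUp_iff hX).1 hχ
    exact hle.trans ((integral_mono (iobj B hB iB) (iobj X hX iX) fun u => hmin u _).trans
      (hge X hX mX iX))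
  · have := hχ.1.1
    obtain ⟨X, hX, mX, rfl⟩ := exists_rep χ
    have iX := (memUp_iff hX).1 hχ.1
    have h1 := (hge X hX mX iX).trans ((hχ.2 _ mB).trans hle)
    have h2 : ∫ u, obj p w (fun j => Q j u) (B u) ∂lam ≤
        ∫ u, obj p w (fun j => Q j u) (X u) ∂lam :=
      integral_mono (iobj B hB iB) (iobj X hX iX) fun u => hmin u _
    have h3 := (integral_eq_iff_of_ae_le (iobj B hB iB) (iobj X hX iX)
      (ae_of_all _ fun u => hmin u _)).1 (le_antisymm h2 h1)
    refine Measure.map_congr ?_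
    filter_upwards [h3] with u hu
    exact obj_unique hp w _ hw hj (hmin u) hu.ge

end WB

/-- Existence of Wasserstein barycenters, and uniqueness when some measure
with positive weight gives no mass to sets of Hausdorff dimension zero ("small sets"). -/
theorem wasserstein_barycenter_exists_and_unique
    (p : ℝ) (hp : 2 ≤ p) (m : ℕ)
    (μs : Fin m → Measure ℝ) (hμs : ∀ j, MemUp p (μs j))
    (w : Fin m → ℝ) (hw : ∀ j, 0 ≤ w j) (hsum : ∑ j, w j = 1) :
    (∃ η : Measure ℝ, IsBarycenter p w μs η) ∧
      ((∃ j, 0 < w j ∧ ∀ s : Set ℝ, dimH s = 0 → μs j s = 0) →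
        ∃! η : Measure ℝ, IsBarycenter p w μs η) := by
  have h := WB.main hp μs hμs w hw hsum
  exact ⟨h.exists, fun _ => h⟩

end
end

section
/- Let μ, ν ∈ 𝒰_p(ℝ) be distinct and let w ∈ (0,1). Then every minimizer η* over 𝒰_p(ℝ) of w·ℓ_p(η,μ)^p + (1−w)·ℓ_p(η,ν)^p satisfies η* ≠ μ, η* ≠ ν, and η* lies on the geodesic segment between μ and ν, i.e. ℓ_p(μ, η*) + ℓ_p(η*, ν) = ℓ_p(μ, ν). -/
open MeasureTheory Filter Topology

noncomputable section

/-- Extended-real version of the Wasserstein distance. -/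
def eW (p : ℝ) (μ ν : Measure ℝ) : ENNReal :=
  (⨅ γ ∈ Couplings μ ν,
      ∫⁻ z : ℝ × ℝ, ENNReal.ofReal (|z.1 - z.2| ^ p) ∂γ) ^ (1 / p)

theorem Wp_eq (p : ℝ) (μ ν : Measure ℝ) : Wp p μ ν = (eW p μ ν).toReal := rfl

theorem cost_eq {Ω : Type*} [MeasurableSpace Ω] (P : Measure Ω) (p : ℝ) (hp : 2 ≤ p)
    (f : Ω → ℝ) :
    (∫⁻ z, ENNReal.ofReal (|f z| ^ p) ∂P) ^ (1 / p) = eLpNorm f (ENNReal.ofReal p) P := by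
  have h0 : 0 < p := by linarith
  rw [eLpNorm_eq_lintegral_rpow_enorm_toReal (by simpa using h0) (by simp),
    ENNReal.toReal_ofReal h0.le]
  congr 2
  ext z
  rw [Real.enorm_eq_ofReal_abs, ENNReal.ofReal_rpow_of_nonneg (abs_nonneg _) h0.le]

theorem eW_le {Ω : Type*} [MeasurableSpace Ω] (P : Measure Ω) [IsProbabilityMeasure P]
    (p : ℝ) (hp : 2 ≤ p) (X Y : Ω → ℝ) (hX : Measurable X) (hY : Measurable Y) :
    eW p (P.map X) (P.map Y) ≤ eLpNorm (fun z => X z - Y z) (ENNReal.ofReal p) P := by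
  have h0 : 0 < p := by linarith
  rw [← cost_eq P p hp]
  refine ENNReal.rpow_le_rpow ?_ (by positivity)
  have hc : P.map (fun z => (X z, Y z)) ∈ Couplings (P.map X) (P.map Y) := by
    refine ⟨Measure.isProbabilityMeasure_map (hX.prodMk hY).aemeasurable, ?_, ?_⟩
    · rw [Measure.map_map measurable_fst (hX.prodMk hY)]; rfl
    · rw [Measure.map_map measurable_snd (hX.prodMk hY)]; rfl
  refine (iInf₂_le _ hc).trans ?_
  rw [lintegral_map (by fun_prop) (hX.prodMk hY)]

theorem exists_coupling (p : ℝ) (hp : 2 ≤ p) (μ ν : Measure ℝ) (r : ENNReal)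
    (h : eW p μ ν < r) :
    ∃ γ ∈ Couplings μ ν, eLpNorm (fun z : ℝ × ℝ => z.1 - z.2) (ENNReal.ofReal p) γ < r := by
  have h0 : 0 < p := by linarith
  unfold eW at h
  rw [one_div, ENNReal.rpow_inv_lt_iff h0] at h
  simp only [iInf_lt_iff] at h
  obtain ⟨γ, hγ, h⟩ := h
  refine ⟨γ, hγ, ?_⟩
  rw [← cost_eq γ p hp, one_div, ENNReal.rpow_inv_lt_iff h0]
  exact h

theorem eW_self (p : ℝ) (hp : 2 ≤ p) (μ : Measure ℝ) [IsProbabilityMeasure μ] :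
    eW p μ μ = 0 := by
  have := eW_le μ p hp id id measurable_id measurable_id
  simpa using this

theorem eW_comm_le (p : ℝ) (hp : 2 ≤ p) (μ ν : Measure ℝ) :
    eW p μ ν ≤ eW p ν μ := by
  refine le_of_forall_gt fun r hr => ?_
  obtain ⟨γ, ⟨h1, h2, h3⟩, h⟩ := exists_coupling p hp ν μ r hr
  have := eW_le γ p hp Prod.snd Prod.fst measurable_snd measurable_fst
  rw [h2, h3] at this
  refine (this.trans_eq ?_).trans_lt h
  rw [← eLpNorm_neg]
  congr 1
  ext z
  simp

theorem eW_comm (p : ℝ) (hp : 2 ≤ p) (μ ν : Measure ℝ) : eW p μ ν = eW p ν μ :=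
  le_antisymm (eW_comm_le p hp μ ν) (eW_comm_le p hp ν μ)

open ProbabilityTheory in
theorem glue (μ η ν : Measure ℝ) (γ₁ γ₂ : Measure (ℝ × ℝ)) (h₁ : γ₁ ∈ Couplings η μ)
    (h₂ : γ₂ ∈ Couplings η ν) :
    ∃ P : Measure (ℝ × ℝ × ℝ), IsProbabilityMeasure P ∧
      P.map (fun z => (z.1, z.2.1)) = γ₁ ∧ P.map (fun z => (z.1, z.2.2)) = γ₂ := by
  obtain ⟨hp1, h1, h1'⟩ := h₁
  obtain ⟨hp2, h2, h2'⟩ := h₂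
  have hη : IsProbabilityMeasure η := h1 ▸ Measure.isProbabilityMeasure_map (by fun_prop)
  have d1 : η ⊗ₘ γ₁.condKernel = γ₁ := by
    have := γ₁.disintegrate γ₁.condKernel
    rwa [Measure.fst, h1] at this
  have d2 : η ⊗ₘ γ₂.condKernel = γ₂ := by
    have := γ₂.disintegrate γ₂.condKernel
    rwa [Measure.fst, h2] at this
  refine ⟨η ⊗ₘ (γ₁.condKernel ×ₖ γ₂.condKernel), inferInstance, ?_, ?_⟩
  · have := Measure.compProd_map (μ := η) (κ := γ₁.condKernel ×ₖ γ₂.condKernel) measurable_fst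
    rw [← Kernel.fst_eq, Kernel.fst_prod, d1] at this
    exact this.symm
  · have := Measure.compProd_map (μ := η) (κ := γ₁.condKernel ×ₖ γ₂.condKernel) measurable_snd
    rw [← Kernel.snd_eq, Kernel.snd_prod, d2] at this
    exact this.symm

theorem eW_triangle (p : ℝ) (hp : 2 ≤ p) (μ η ν : Measure ℝ) :
    eW p μ ν ≤ eW p μ η + eW p η ν := by
  rw [eW_comm p hp μ η]
  refine le_of_forall_gt fun r hr => ?_
  obtain ⟨a, ha, b, hb, hab⟩ : ∃ a, eW p η μ < a ∧ ∃ b, eW p η ν < b ∧ a + b < r := by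
    obtain ⟨a, ha, b, hb, hab⟩ := ENNReal.exists_add_lt_of_add_lt hr
    exact ⟨a, ha, b, hb, hab⟩
  obtain ⟨γ₁, h₁, c₁⟩ := exists_coupling p hp η μ a ha
  obtain ⟨γ₂, h₂, c₂⟩ := exists_coupling p hp η ν b hb
  obtain ⟨P, hP, m₁, m₂⟩ := glue μ η ν γ₁ γ₂ h₁ h₂
  have key := eW_le P p hp (fun z => z.2.1) (fun z => z.2.2) (by fun_prop) (by fun_prop)
  have e1 : P.map (fun z => z.2.1) = μ := by
    rw [← h₁.2.2, ← m₁, Measure.map_map (by fun_prop) (by fun_prop)]; rfl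
  have e2 : P.map (fun z => z.2.2) = ν := by
    rw [← h₂.2.2, ← m₂, Measure.map_map (by fun_prop) (by fun_prop)]; rfl
  rw [e1, e2] at key
  rw [← m₁, eLpNorm_map_measure (by fun_prop) (by fun_prop)] at c₁
  rw [← m₂, eLpNorm_map_measure (by fun_prop) (by fun_prop)] at c₂
  have heq : (fun z : ℝ × ℝ × ℝ => z.2.1 - z.2.2) =
      ((fun z : ℝ × ℝ => z.1 - z.2) ∘ fun z : ℝ × ℝ × ℝ => (z.1, z.2.2)) -
      ((fun z : ℝ × ℝ => z.1 - z.2) ∘ fun z : ℝ × ℝ × ℝ => (z.1, z.2.1)) := by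
    ext z; simp
  rw [heq] at key
  have hmink := eLpNorm_sub_le (μ := P) (p := ENNReal.ofReal p)
    (f := ((fun z : ℝ × ℝ => z.1 - z.2) ∘ fun z : ℝ × ℝ × ℝ => (z.1, z.2.2)))
    (g := ((fun z : ℝ × ℝ => z.1 - z.2) ∘ fun z : ℝ × ℝ × ℝ => (z.1, z.2.1)))
    (Measurable.aestronglyMeasurable (by fun_prop))
    (Measurable.aestronglyMeasurable (by fun_prop))
    (by rw [ENNReal.one_le_ofReal]; linarith)
  refine (key.trans hmink).trans_lt (lt_of_le_of_lt ?_ hab)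
  rw [add_comm]
  exact add_le_add c₁.le c₂.le

theorem memUp_memLp (p : ℝ) (hp : 2 ≤ p) (μ : Measure ℝ) (hμ : MemUp p μ) :
    MemLp (fun x => x) (ENNReal.ofReal p) μ := by
  have h0 : 0 < p := by linarith
  refine ⟨by fun_prop, ?_⟩
  rw [← cost_eq μ p hp]
  exact ENNReal.rpow_lt_top_of_nonneg (by positivity) hμ.2.ne

theorem memUp_of_memLp (p : ℝ) (hp : 2 ≤ p) (μ : Measure ℝ) [IsProbabilityMeasure μ]
    (h : MemLp (fun x => x) (ENNReal.ofReal p) μ) : MemUp p μ := by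
  have h0 : 0 < p := by linarith
  refine ⟨inferInstance, ?_⟩
  have := h.2
  rw [← cost_eq μ p hp, one_div, ENNReal.rpow_inv_lt_iff h0, ENNReal.top_rpow_of_pos h0] at this
  exact this

theorem eW_lt_top (p : ℝ) (hp : 2 ≤ p) (μ ν : Measure ℝ) (hμ : MemUp p μ) (hν : MemUp p ν) :
    eW p μ ν < ⊤ := by
  have key : ∀ ρ : Measure ℝ, MemUp p ρ → eW p ρ (Measure.dirac 0) < ⊤ := by
    intro ρ hρ
    have := hρ.1
    have h := eW_le ρ p hp id (fun _ => 0) measurable_id measurable_const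
    rw [Measure.map_id, Measure.map_const, measure_univ, one_smul] at h
    refine h.trans_lt ?_
    simpa using (memUp_memLp p hp ρ hρ).2
  refine (eW_triangle p hp μ (Measure.dirac 0) ν).trans_lt ?_
  rw [eW_comm p hp (Measure.dirac 0) ν]
  exact ENNReal.add_lt_top.2 ⟨key μ hμ, key ν hν⟩

theorem Iic_le (p : ℝ) (hp : 2 ≤ p) (μ ν : Measure ℝ) (h : eW p μ ν = 0) (x y : ℝ)
    (hxy : x < y) : μ (Set.Iic x) ≤ ν (Set.Iic y) := by
  have h0 : 0 < p := by linarith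
  have hδ : 0 < ENNReal.ofReal (y - x) := by simpa using hxy
  refine ENNReal.le_of_forall_pos_le_add fun ε hε _ => ?_
  have hε' : (0 : ENNReal) < (ε : ENNReal) ^ (1 / p) :=
    ENNReal.rpow_pos (by simpa using hε) (by simp)
  obtain ⟨γ, ⟨g1, g2, g3⟩, hγ⟩ := exists_coupling p hp μ ν
    (ENNReal.ofReal (y - x) * (ε : ENNReal) ^ (1 / p))
    (by rw [h]; exact ENNReal.mul_pos hδ.ne' hε'.ne')
  have hm := meas_ge_le_mul_pow_eLpNorm_enorm γ (p := ENNReal.ofReal p) (by simpa using h0)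
    (by simp) (f := fun z : ℝ × ℝ => z.1 - z.2)
    (Measurable.aestronglyMeasurable (by fun_prop)) (ε := ENNReal.ofReal (y - x)) hδ.ne'
    (by simp)
  rw [← g2, ← g3, Measure.map_apply measurable_fst measurableSet_Iic,
    Measure.map_apply measurable_snd measurableSet_Iic]
  have hsub : (Prod.fst ⁻¹' Set.Iic x : Set (ℝ × ℝ)) ⊆ Prod.snd ⁻¹' Set.Iic y ∪
      {z : ℝ × ℝ | ENNReal.ofReal (y - x) ≤ ‖z.1 - z.2‖ₑ} := by
    rintro ⟨a, b⟩ ha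
    simp only [Set.mem_preimage, Set.mem_Iic, Set.mem_union, Set.mem_ofPred_eq] at ha ⊢
    by_cases hb : b ≤ y
    · exact Or.inl hb
    · right
      rw [Real.enorm_eq_ofReal_abs]
      apply ENNReal.ofReal_le_ofReal
      rw [abs_sub_comm]
      exact le_trans (by linarith) (le_abs_self _)
  refine (measure_mono hsub).trans ((measure_union_le _ _).trans (add_le_add le_rfl ?_))
  refine hm.trans ?_
  rw [ENNReal.toReal_ofReal h0.le, ← ENNReal.mul_rpow_of_nonneg _ _ h0.le]
  calc _ ≤ ((ENNReal.ofReal (y - x))⁻¹ *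
        (ENNReal.ofReal (y - x) * (ε : ENNReal) ^ (1 / p))) ^ p := by gcongr
    _ = ε := by
      rw [← mul_assoc, ENNReal.inv_mul_cancel hδ.ne' (by simp), one_mul, ← ENNReal.rpow_mul,
        one_div, inv_mul_cancel₀ h0.ne', ENNReal.rpow_one]

open ProbabilityTheory in
theorem cdf_le_of_eW (p : ℝ) (hp : 2 ≤ p) (μ ν : Measure ℝ) [IsProbabilityMeasure μ]
    [IsProbabilityMeasure ν] (h : eW p μ ν = 0) (x : ℝ) : cdf μ x ≤ cdf ν x := by
  have ht : Tendsto (cdf ν) (𝓝[>] x) (𝓝 (cdf ν x)) :=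
    ((cdf ν).right_continuous x).mono Set.Ioi_subset_Ici_self
  refine ge_of_tendsto ht ?_
  filter_upwards [self_mem_nhdsWithin] with y hy
  rw [cdf_eq_real, cdf_eq_real]
  exact ENNReal.toReal_mono (measure_ne_top _ _) (Iic_le p hp μ ν h x y hy)

theorem eq_of_eW (p : ℝ) (hp : 2 ≤ p) (μ ν : Measure ℝ) [IsProbabilityMeasure μ]
    [IsProbabilityMeasure ν] (h : eW p μ ν = 0) : μ = ν := by
  apply Measure.eq_of_cdf
  ext x
  exact le_antisymm (cdf_le_of_eW p hp μ ν h x)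
    (cdf_le_of_eW p hp ν μ (by rw [eW_comm p hp, h]) x)

theorem exists_interp (p : ℝ) (hp : 2 ≤ p) (μ ν : Measure ℝ) (hμ : MemUp p μ) (hν : MemUp p ν)
    (t : ℝ) (ht : t ∈ Set.Icc (0 : ℝ) 1) (r : ℝ) (hr : Wp p μ ν < r) :
    ∃ χ, MemUp p χ ∧ Wp p χ μ ≤ t * r ∧ Wp p χ ν ≤ (1 - t) * r := by
  have hr0 : 0 < r := lt_of_le_of_lt ENNReal.toReal_nonneg hr
  have hlt : eW p μ ν < ENNReal.ofReal r :=
    (ENNReal.lt_ofReal_iff_toReal_lt (eW_lt_top p hp μ ν hμ hν).ne).2 hr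
  obtain ⟨γ, ⟨g1, g2, g3⟩, hγ⟩ := exists_coupling p hp μ ν _ hlt
  have hZ : Measurable (fun z : ℝ × ℝ => (1 - t) * z.1 + t * z.2) := by fun_prop
  have hpr : IsProbabilityMeasure (γ.map (fun z : ℝ × ℝ => (1 - t) * z.1 + t * z.2)) :=
    Measure.isProbabilityMeasure_map hZ.aemeasurable
  have b1 := eW_le γ p hp (fun z : ℝ × ℝ => (1 - t) * z.1 + t * z.2) Prod.fst hZ measurable_fst
  have b2 := eW_le γ p hp (fun z : ℝ × ℝ => (1 - t) * z.1 + t * z.2) Prod.snd hZ measurable_snd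
  have e1 : (fun z : ℝ × ℝ => (1 - t) * z.1 + t * z.2 - z.1) =
      (-t) • (fun z : ℝ × ℝ => z.1 - z.2) := by
    ext z; simp only [Pi.smul_apply, smul_eq_mul]; ring
  have e2 : (fun z : ℝ × ℝ => (1 - t) * z.1 + t * z.2 - z.2) =
      (1 - t) • (fun z : ℝ × ℝ => z.1 - z.2) := by
    ext z; simp only [Pi.smul_apply, smul_eq_mul]; ring
  rw [g2, e1, eLpNorm_const_smul, enorm_neg, Real.enorm_of_nonneg ht.1] at b1
  rw [g3, e2, eLpNorm_const_smul, Real.enorm_of_nonneg (by linarith [ht.2])] at b2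
  refine ⟨γ.map (fun z : ℝ × ℝ => (1 - t) * z.1 + t * z.2), ?_, ?_, ?_⟩
  · apply memUp_of_memLp p hp
    rw [memLp_map_measure_iff (by fun_prop) hZ.aemeasurable]
    have m1 := memUp_memLp p hp μ hμ
    have m2 := memUp_memLp p hp ν hν
    rw [← g2, memLp_map_measure_iff (by fun_prop) (by fun_prop)] at m1
    rw [← g3, memLp_map_measure_iff (by fun_prop) (by fun_prop)] at m2
    exact (m1.const_mul (1 - t)).add (m2.const_mul t)
  · refine ENNReal.toReal_le_of_le_ofReal (mul_nonneg ht.1 hr0.le) (b1.trans ?_)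
    rw [ENNReal.ofReal_mul ht.1]
    gcongr
  · have h1t : 0 ≤ 1 - t := by linarith [ht.2]
    refine ENNReal.toReal_le_of_le_ofReal (mul_nonneg h1t hr0.le) (b2.trans ?_)
    rw [ENNReal.ofReal_mul h1t]
    gcongr

/-- The scalar contradiction at an endpoint. -/
theorem endpoint_absurd (p : ℝ) (hp : 2 ≤ p) (w D : ℝ) (hw : w ∈ Set.Ioo (0 : ℝ) 1)
    (hD : 0 < D)
    (h : ∀ t ∈ Set.Icc (0 : ℝ) 1,
      (1 - w) * D ^ p ≤ w * (t * D) ^ p + (1 - w) * ((1 - t) * D) ^ p) : False := by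
  obtain ⟨h1, h2⟩ := hw
  have hDp : 0 < D ^ p := Real.rpow_pos_of_pos hD p
  set t : ℝ := (1 - w) / 2 with htdef
  have ht0 : 0 < t := by rw [htdef]; linarith
  have ht1 : t < 1 := by rw [htdef]; linarith
  have := h t ⟨ht0.le, ht1.le⟩
  rw [Real.mul_rpow ht0.le hD.le, Real.mul_rpow (by linarith) hD.le] at this
  have a1 : t ^ p ≤ t ^ 2 := by
    rw [← Real.rpow_two]
    exact Real.rpow_le_rpow_of_exponent_ge ht0 ht1.le hp
  have a2 : (1 - t) ^ p ≤ 1 - t := by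
    conv_rhs => rw [← Real.rpow_one (1 - t)]
    exact Real.rpow_le_rpow_of_exponent_ge (by linarith) (by linarith) (by linarith)
  have h3 : (1 - w) ≤ w * t ^ p + (1 - w) * (1 - t) ^ p := by
    refine le_of_mul_le_mul_right ?_ hDp
    linarith
  have h4 : (1 - w) ≤ w * t ^ 2 + (1 - w) * (1 - t) := by
    have := mul_le_mul_of_nonneg_left a1 h1.le
    have := mul_le_mul_of_nonneg_left a2 (by linarith : 0 ≤ 1 - w)
    linarith
  have h5 : (1 - w) * t ≤ (w * t) * t := by nlinarith
  have h6 : 1 - w ≤ w * t := le_of_mul_le_mul_right h5 ht0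
  rw [htdef] at h6
  nlinarith

/-- For distinct `μ, ν ∈ 𝒰_p(ℝ)` and `w ∈ (0,1)`, every minimizer `η*` over
`𝒰_p(ℝ)` of `w ℓ_p(η,μ)^p + (1-w) ℓ_p(η,ν)^p` is distinct from `μ` and from `ν` and lies on
the geodesic segment between them: `ℓ_p(μ,η*) + ℓ_p(η*,ν) = ℓ_p(μ,ν)`. -/
theorem two_point_barycenter_strictly_between
    (p : ℝ) (hp : 2 ≤ p)
    (μ ν : Measure ℝ) (hμ : MemUp p μ) (hν : MemUp p ν) (hne : μ ≠ ν)
    (w : ℝ) (hw : w ∈ Set.Ioo (0 : ℝ) 1)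
    (η : Measure ℝ) (hη : MemUp p η)
    (hmin : ∀ χ : Measure ℝ, MemUp p χ →
      w * Wp p η μ ^ p + (1 - w) * Wp p η ν ^ p ≤
        w * Wp p χ μ ^ p + (1 - w) * Wp p χ ν ^ p) :
    η ≠ μ ∧ η ≠ ν ∧ Wp p μ η + Wp p η ν = Wp p μ ν := by
  have h0 : 0 < p := by linarith
  have := hμ.1
  have := hν.1
  have := hη.1
  have hcomm : ∀ a b : Measure ℝ, Wp p a b = Wp p b a := fun a b => by
    rw [Wp_eq, Wp_eq, eW_comm p hp]
  have hnn : ∀ a b : Measure ℝ, 0 ≤ Wp p a b := fun a b => ENNReal.toReal_nonneg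
  have hself : ∀ a : Measure ℝ, IsProbabilityMeasure a → Wp p a a = 0 := fun a ha => by
    rw [Wp_eq, eW_self p hp, ENNReal.toReal_zero]
  have hD : 0 < Wp p μ ν := by
    rw [Wp_eq]
    refine ENNReal.toReal_pos (fun h => hne (eq_of_eW p hp μ ν h))
      (eW_lt_top p hp μ ν hμ hν).ne
  obtain ⟨hw0, hw1⟩ := hw
  have hw1' : 0 < 1 - w := by linarith
  -- comparison with the geodesic interpolants
  have hr : ∀ t ∈ Set.Icc (0 : ℝ) 1, ∀ r, Wp p μ ν < r →
      w * Wp p η μ ^ p + (1 - w) * Wp p η ν ^ p ≤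
        w * (t * r) ^ p + (1 - w) * ((1 - t) * r) ^ p := by
    intro t ht r hr
    obtain ⟨χ, hχ, c1, c2⟩ := exists_interp p hp μ ν hμ hν t ht r hr
    refine (hmin χ hχ).trans ?_
    have d1 := Real.rpow_le_rpow (hnn χ μ) c1 h0.le
    have d2 := Real.rpow_le_rpow (hnn χ ν) c2 h0.le
    gcongr
  have hD' : ∀ t ∈ Set.Icc (0 : ℝ) 1,
      w * Wp p η μ ^ p + (1 - w) * Wp p η ν ^ p ≤
        w * (t * Wp p μ ν) ^ p + (1 - w) * ((1 - t) * Wp p μ ν) ^ p := by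
    intro t ht
    have hc : Continuous fun r : ℝ => w * (t * r) ^ p + (1 - w) * ((1 - t) * r) ^ p := by
      have := Real.continuous_rpow_const h0.le
      exact (continuous_const.mul (this.comp (continuous_const.mul continuous_id))).add
        (continuous_const.mul (this.comp (continuous_const.mul continuous_id)))
    refine ge_of_tendsto ((hc.tendsto (Wp p μ ν)).mono_left
      (nhdsWithin_le_nhds (s := Set.Ioi (Wp p μ ν)))) ?_
    filter_upwards [self_mem_nhdsWithin] with r hr'
    exact hr t ht r hr'
  refine ⟨?_, ?_, ?_⟩
  · rintro rfl
    refine endpoint_absurd p hp w (Wp p η ν) ⟨hw0, hw1⟩ hD fun t ht => ?_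
    have := hD' t ht
    rw [hself η inferInstance, Real.zero_rpow h0.ne'] at this
    linarith
  · rintro rfl
    refine endpoint_absurd p hp (1 - w) (Wp p μ η) ⟨hw1', by linarith⟩ hD fun t ht => ?_
    have := hD' (1 - t) ⟨by linarith [ht.2], by linarith [ht.1]⟩
    rw [hself η inferInstance, Real.zero_rpow h0.ne', hcomm η μ] at this
    rw [sub_sub_cancel] at this ⊢
    linarith
  · apply le_antisymm
    · by_contra hlt
      push Not at hlt
      have ha := hnn μ η
      have hb := hnn η ν
      rw [hcomm η μ] at hD'
      set a := Wp p μ η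
      set b := Wp p η ν
      set D := Wp p μ ν
      have hab : 0 < a + b := hD.trans hlt
      have hk : (D / (a + b)) ^ p < 1 :=
        Real.rpow_lt_one (by positivity) ((div_lt_one hab).2 hlt) h0
      have := hD' (a / (a + b)) ⟨by positivity, (div_le_one hab).2 (by linarith)⟩
      have e1 : a / (a + b) * D = a * (D / (a + b)) := by ring
      have e2 : (1 - a / (a + b)) * D = b * (D / (a + b)) := by field_simp; ring
      rw [e1, e2, Real.mul_rpow ha (by positivity), Real.mul_rpow hb (by positivity)] at this
      have hpos : 0 < w * a ^ p + (1 - w) * b ^ p := by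
        rcases ha.lt_or_eq with h | h
        · have := Real.rpow_pos_of_pos h p
          positivity
        · have hb' : 0 < b := by linarith
          have := Real.rpow_pos_of_pos hb' p
          positivity
      nlinarith
    · rw [Wp_eq, Wp_eq, Wp_eq, ← ENNReal.toReal_add (eW_lt_top p hp μ η hμ hη).ne
        (eW_lt_top p hp η ν hη hν).ne]
      exact ENNReal.toReal_mono (ENNReal.add_lt_top.2
        ⟨eW_lt_top p hp μ η hμ hη, eW_lt_top p hp η ν hη hν⟩).ne (eW_triangle p hp μ η ν)

end
end

section
/- Suppose the undirected network graph 𝒢(𝒱,ℰ) is time-invariant and connected, and each of the n ≥ 2 agents updates its state μ_i(t) ∈ 𝒰_p(ℝ) by the Wasserstein consensus protocol. Then there exists μ* ∈ 𝒰_p(ℝ) such that lim_{t→∞} ℓ_p(μ_i(t), μ*) = 0 for every i ∈ 𝒱. -/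
open MeasureTheory Filter Topology

noncomputable section

/-- Lebesgue measure on the unit interval. -/
def UU : Measure ℝ := volume.restrict (Set.Ioo (0 : ℝ) 1)

instance UU_prob : IsProbabilityMeasure UU := by
  constructor
  simp [UU]

lemma UU_aemeas {f : ℝ → ℝ} (hf : MonotoneOn f (Set.Ioo (0 : ℝ) 1)) : AEMeasurable f UU :=
  aemeasurable_restrict_of_monotoneOn measurableSet_Ioo hf

lemma UU_ae_mem : ∀ᵐ u ∂UU, u ∈ Set.Ioo (0 : ℝ) 1 :=
  ae_restrict_mem measurableSet_Ioo

/-- Radial layer-cake formula for the power `d ^ p`. -/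
lemma layer_pow (p : ℝ) (hp : 2 ≤ p) (d : ℝ) (hd : 0 ≤ d) :
    ∫⁻ v in Set.Ioi (0 : ℝ), ENNReal.ofReal (p * (p - 1) * v ^ (p - 2)) * ENNReal.ofReal (d - v)
      = ENNReal.ofReal (d ^ p) := by
  have hcont : Continuous (fun v : ℝ => p * (p - 1) * v ^ (p - 2) * (d - v)) := by
    have : Continuous (fun v : ℝ => v ^ (p - 2)) := Real.continuous_rpow_const (by linarith)
    fun_prop
  have h1 : ∫⁻ v in Set.Ioi (0 : ℝ),
      ENNReal.ofReal (p * (p - 1) * v ^ (p - 2)) * ENNReal.ofReal (d - v)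
      = ∫⁻ v in Set.Ioc (0 : ℝ) d, ENNReal.ofReal (p * (p - 1) * v ^ (p - 2) * (d - v)) := by
    rw [← lintegral_indicator measurableSet_Ioi, ← lintegral_indicator measurableSet_Ioc]
    congr 1
    funext v
    by_cases hv : 0 < v
    · have hnn : 0 ≤ p * (p - 1) * v ^ (p - 2) :=
        mul_nonneg (mul_nonneg (by linarith) (by linarith)) (Real.rpow_nonneg hv.le _)
      by_cases hvd : v ≤ d
      · simp only [Set.indicator, Set.mem_Ioi, Set.mem_Ioc, hv, hvd, and_self, if_true]
        rw [ENNReal.ofReal_mul hnn]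
      · simp only [Set.indicator, Set.mem_Ioi, Set.mem_Ioc, hv, hvd, and_false, if_true, if_false]
        rw [ENNReal.ofReal_of_nonpos (p := d - v) (by linarith), mul_zero]
    · simp [Set.indicator, hv]
  rw [h1, ← ofReal_integral_eq_lintegral_ofReal]
  · congr 1
    rw [← intervalIntegral.integral_of_le hd]
    have e : ∀ v ∈ Set.uIcc 0 d, p * (p - 1) * v ^ (p - 2) * (d - v)
        = (p * (p - 1) * d) * v ^ (p - 2) - (p * (p - 1)) * v ^ (p - 1) := by
      intro v hv
      rw [Set.uIcc_of_le hd] at hv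
      rcases hv.1.eq_or_lt with h0 | h0
      · subst h0
        rw [Real.zero_rpow (by linarith : p - 1 ≠ 0)]
        ring
      · have : v ^ (p - 1) = v ^ (p - 2) * v := by
          rw [← Real.rpow_add_one h0.ne']
          congr 1
          ring
        rw [this]
        ring
    rw [intervalIntegral.integral_congr e, intervalIntegral.integral_sub,
      intervalIntegral.integral_const_mul, intervalIntegral.integral_const_mul,
      integral_rpow (Or.inl (by linarith)), integral_rpow (Or.inl (by linarith))]
    · rw [show p - 2 + 1 = p - 1 by ring, show p - 1 + 1 = p by ring,
        Real.zero_rpow (by linarith : p - 1 ≠ 0), Real.zero_rpow (by linarith : p ≠ 0)]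
      have h1 : p - 1 ≠ 0 := by linarith
      have h2 : p ≠ 0 := by linarith
      rcases hd.eq_or_lt with h0 | h0
      · subst h0
        rw [Real.zero_rpow (by linarith : p - 1 ≠ 0), Real.zero_rpow (by linarith : p ≠ 0)]
        ring
      · have : d ^ p = d ^ (p - 1) * d := by
          rw [← Real.rpow_add_one h0.ne']
          congr 1
          ring
        rw [this]
        field_simp
        ring
    · exact (continuous_const.mul (Real.continuous_rpow_const (by linarith))).intervalIntegrable _ _
    · exact (continuous_const.mul (Real.continuous_rpow_const (by linarith))).intervalIntegrable _ _
  · exact (hcont.integrableOn_Icc (a := 0) (b := d)).mono_set Set.Ioc_subset_Icc_self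
  · refine (ae_restrict_iff' measurableSet_Ioc).2 (Eventually.of_forall fun v hv => ?_)
    exact mul_nonneg (mul_nonneg (mul_nonneg (by linarith) (by linarith))
      (Real.rpow_nonneg hv.1.le _)) (by linarith [hv.2])

lemma layer_abs (x y v : ℝ) (hv : 0 < v) :
    ENNReal.ofReal (|x - y| - v) =
      ∫⁻ s : ℝ, ((Set.indicator {z : ℝ × ℝ | z.1 ≤ s ∧ s + v < z.2} 1 (x, y) : ENNReal) +
        Set.indicator {z : ℝ × ℝ | z.2 ≤ s ∧ s + v < z.1} 1 (x, y)) := by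
  have e1 : ∀ s : ℝ, (Set.indicator {z : ℝ × ℝ | z.1 ≤ s ∧ s + v < z.2} 1 (x, y) : ENNReal)
      = Set.indicator (Set.Ico x (y - v)) 1 s := by
    intro s
    simp only [Set.indicator, Set.mem_ofPred_eq, Set.mem_Ico, lt_sub_iff_add_lt, Pi.one_apply]
  have e2 : ∀ s : ℝ, (Set.indicator {z : ℝ × ℝ | z.2 ≤ s ∧ s + v < z.1} 1 (x, y) : ENNReal)
      = Set.indicator (Set.Ico y (x - v)) 1 s := by
    intro s
    simp only [Set.indicator, Set.mem_ofPred_eq, Set.mem_Ico, lt_sub_iff_add_lt, Pi.one_apply]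
  simp_rw [e1, e2]
  rw [lintegral_add_left (measurable_one.indicator measurableSet_Ico),
    lintegral_indicator_one measurableSet_Ico, lintegral_indicator_one measurableSet_Ico,
    Real.volume_Ico, Real.volume_Ico]
  rcases le_total x y with h | h
  · rw [ENNReal.ofReal_of_nonpos (p := x - v - y) (by linarith), add_zero, abs_of_nonpos (by linarith)]
    congr 1
    ring
  · rw [ENNReal.ofReal_of_nonpos (p := y - v - x) (by linarith), zero_add, abs_of_nonneg (by linarith)]
    congr 1
    ring

lemma cost_formula (p : ℝ) (hp : 2 ≤ p) (γ : Measure (ℝ × ℝ)) [IsProbabilityMeasure γ] :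
    ∫⁻ z : ℝ × ℝ, ENNReal.ofReal (|z.1 - z.2| ^ p) ∂γ =
      ∫⁻ v in Set.Ioi (0 : ℝ), ENNReal.ofReal (p * (p - 1) * v ^ (p - 2)) *
        ∫⁻ s : ℝ, (γ {z : ℝ × ℝ | z.1 ≤ s ∧ s + v < z.2} +
          γ {z : ℝ × ℝ | z.2 ≤ s ∧ s + v < z.1}) := by
  have hm : Measurable (fun v : ℝ => ENNReal.ofReal (p * (p - 1) * v ^ (p - 2))) := by fun_prop
  have hms1 : ∀ s v : ℝ, MeasurableSet {z : ℝ × ℝ | z.1 ≤ s ∧ s + v < z.2} := fun s v =>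
    (measurableSet_le measurable_fst measurable_const).inter
      (measurableSet_lt measurable_const measurable_snd)
  have hms2 : ∀ s v : ℝ, MeasurableSet {z : ℝ × ℝ | z.2 ≤ s ∧ s + v < z.1} := fun s v =>
    (measurableSet_le measurable_snd measurable_const).inter
      (measurableSet_lt measurable_const measurable_fst)
  calc ∫⁻ z : ℝ × ℝ, ENNReal.ofReal (|z.1 - z.2| ^ p) ∂γ
      = ∫⁻ z : ℝ × ℝ, (∫⁻ v in Set.Ioi (0 : ℝ), ENNReal.ofReal (p * (p - 1) * v ^ (p - 2)) *
          ENNReal.ofReal (|z.1 - z.2| - v)) ∂γ := by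
        refine lintegral_congr fun z => ?_
        rw [layer_pow p hp _ (abs_nonneg _)]
    _ = ∫⁻ v in Set.Ioi (0 : ℝ), ∫⁻ z : ℝ × ℝ, ENNReal.ofReal (p * (p - 1) * v ^ (p - 2)) *
          ENNReal.ofReal (|z.1 - z.2| - v) ∂γ := by
        apply lintegral_lintegral_swap
        apply Measurable.aemeasurable
        simp only [Function.uncurry_def]
        fun_prop
    _ = _ := by
        refine setLIntegral_congr_fun measurableSet_Ioi fun v hv => ?_
        rw [lintegral_const_mul _ (by fun_prop)]
        congr 1
        simp_rw [layer_abs _ _ v hv]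
        rw [lintegral_lintegral_swap]
        · refine lintegral_congr fun s => ?_
          rw [lintegral_add_left]
          · rw [lintegral_indicator_one (hms1 s v), lintegral_indicator_one (hms2 s v)]
          · exact measurable_one.indicator (hms1 s v)
        · apply Measurable.aemeasurable
          simp only [Function.uncurry_def]
          apply Measurable.add
          · have : MeasurableSet {q : (ℝ × ℝ) × ℝ | q.1.1 ≤ q.2 ∧ q.2 + v < q.1.2} :=
              (measurableSet_le measurable_fst.fst measurable_snd).inter
                (measurableSet_lt (measurable_snd.add_const v) measurable_fst.snd)
            exact (measurable_one (α := ENNReal)).indicator this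
          · have : MeasurableSet {q : (ℝ × ℝ) × ℝ | q.1.2 ≤ q.2 ∧ q.2 + v < q.1.1} :=
              (measurableSet_le measurable_fst.snd measurable_snd).inter
                (measurableSet_lt (measurable_snd.add_const v) measurable_fst.fst)
            exact (measurable_one (α := ENNReal)).indicator this

/-- Sublevel sets of monotone functions are nested, hence the comonotone coupling minimizes
the mass of quadrants. -/
lemma quadrant_le {f g : ℝ → ℝ} (hf : MonotoneOn f (Set.Ioo (0 : ℝ) 1))
    (hg : MonotoneOn g (Set.Ioo (0 : ℝ) 1)) (γ : Measure (ℝ × ℝ)) {X Y : ℝ × ℝ → ℝ}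
    (hX : Measurable X) (hY : Measurable Y)
    (h1 : γ.map X = UU.map f) (h2 : γ.map Y = UU.map g) (s r : ℝ) :
    UU {u | f u ≤ s ∧ r < g u} ≤ γ {z | X z ≤ s ∧ r < Y z} := by
  set A : Set ℝ := {u | f u ≤ s} with hA
  set B : Set ℝ := {u | g u ≤ r} with hB
  have hBm : NullMeasurableSet B UU := (UU_aemeas hg).nullMeasurable measurableSet_Iic
  have hset : {u | f u ≤ s ∧ r < g u} = A \ B := by
    ext u
    simp [hA, hB]
  rw [hset]
  have hγA : γ {z | X z ≤ s} = UU A := by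
    have := congrArg (fun m => m (Set.Iic s)) h1
    simp only [Measure.map_apply hX measurableSet_Iic,
      Measure.map_apply_of_aemeasurable (UU_aemeas hf) measurableSet_Iic] at this
    exact this
  have hγB : γ {z | Y z ≤ r} = UU B := by
    have := congrArg (fun m => m (Set.Iic r)) h2
    simp only [Measure.map_apply hY measurableSet_Iic,
      Measure.map_apply_of_aemeasurable (UU_aemeas hg) measurableSet_Iic] at this
    exact this
  have hsplit := measure_inter_add_sdiff₀ (μ := UU) A hBm
  by_cases hsub : ∀ u ∈ Set.Ioo (0 : ℝ) 1, u ∈ A → u ∈ B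
  · have : UU (A \ B) = 0 := by
      rw [measure_eq_zero_iff_ae_notMem]
      filter_upwards [UU_ae_mem] with u hu h
      exact h.2 (hsub u hu h.1)
    rw [this]
    exact zero_le
  · push Not at hsub
    obtain ⟨u0, hu0, hu0A, hu0B⟩ := hsub
    have hAB : UU (A ∩ B) = UU B := by
      apply measure_congr
      filter_upwards [UU_ae_mem] with u hu
      apply propext
      constructor
      · intro h
        exact h.2
      · intro h
        refine ⟨?_, h⟩
        have hlt : u ≤ u0 := by
          by_contra hcon
          exact hu0B ((hg hu0 hu (not_le.1 hcon).le).trans h)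
        exact (hf hu hu0 hlt).trans hu0A
    have hle : UU A ≤ γ {z | X z ≤ s ∧ r < Y z} + UU B := by
      rw [← hγA, ← hγB]
      refine le_trans (measure_mono ?_) (measure_union_le _ _)
      intro z hz
      by_cases h : Y z ≤ r
      · exact Or.inr h
      · exact Or.inl ⟨hz, not_le.1 h⟩
    rw [← hsplit, hAB, add_comm] at hle
    exact (ENNReal.add_le_add_iff_right (measure_ne_top UU B)).1 hle

lemma transport_eq (p : ℝ) (hp : 2 ≤ p) {f g : ℝ → ℝ} (hf : MonotoneOn f (Set.Ioo (0 : ℝ) 1))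
    (hg : MonotoneOn g (Set.Ioo (0 : ℝ) 1)) :
    (⨅ γ ∈ Couplings (UU.map f) (UU.map g),
      ∫⁻ z : ℝ × ℝ, ENNReal.ofReal (|z.1 - z.2| ^ p) ∂γ)
      = ∫⁻ u, ENNReal.ofReal (|f u - g u| ^ p) ∂UU := by
  have hfm := UU_aemeas hf
  have hgm := UU_aemeas hg
  have hfg : AEMeasurable (fun u => (f u, g u)) UU := hfm.prodMk hgm
  have hprob : IsProbabilityMeasure (UU.map fun u => (f u, g u)) :=
    Measure.isProbabilityMeasure_map hfg
  have hcost : ∫⁻ z : ℝ × ℝ, ENNReal.ofReal (|z.1 - z.2| ^ p) ∂(UU.map fun u => (f u, g u))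
      = ∫⁻ u, ENNReal.ofReal (|f u - g u| ^ p) ∂UU := by
    rw [lintegral_map' (by fun_prop) hfg]
  apply le_antisymm
  · rw [← hcost]
    refine iInf₂_le _ ⟨hprob, ?_, ?_⟩
    · rw [AEMeasurable.map_map_of_aemeasurable (by fun_prop) hfg]
      rfl
    · rw [AEMeasurable.map_map_of_aemeasurable (by fun_prop) hfg]
      rfl
  · refine le_iInf₂ fun γ hγ => ?_
    obtain ⟨hγp, hγ1, hγ2⟩ := hγ
    rw [← hcost, cost_formula p hp, cost_formula p hp]
    refine lintegral_mono fun v => ?_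
    simp only
    refine mul_le_mul_right (lintegral_mono fun s => add_le_add ?_ ?_) _
    · rw [Measure.map_apply_of_aemeasurable hfg]
      · exact quadrant_le hf hg γ measurable_fst measurable_snd hγ1 hγ2 _ _
      · exact (measurableSet_le measurable_fst measurable_const).inter
          (measurableSet_lt measurable_const measurable_snd)
    · rw [Measure.map_apply_of_aemeasurable hfg]
      · exact quadrant_le hg hf γ measurable_snd measurable_fst hγ2 hγ1 _ _
      · exact (measurableSet_le measurable_snd measurable_const).inter
          (measurableSet_lt measurable_const measurable_fst)

lemma Wp_eq_s8 (p : ℝ) (hp : 2 ≤ p) {f g : ℝ → ℝ} (hf : MonotoneOn f (Set.Ioo (0 : ℝ) 1))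
    (hg : MonotoneOn g (Set.Ioo (0 : ℝ) 1)) :
    Wp p (UU.map f) (UU.map g) = ((∫⁻ u, ENNReal.ofReal (|f u - g u| ^ p) ∂UU) ^ (1 / p)).toReal := by
  rw [Wp, transport_eq p hp hf hg]

lemma Wp_pow (p : ℝ) (hp : 2 ≤ p) {f g : ℝ → ℝ} (hf : MonotoneOn f (Set.Ioo (0 : ℝ) 1))
    (hg : MonotoneOn g (Set.Ioo (0 : ℝ) 1)) :
    Wp p (UU.map f) (UU.map g) ^ p = ∫ u, |f u - g u| ^ p ∂UU := by
  rw [Wp_eq_s8 p hp hf hg, ENNReal.toReal_rpow, ← ENNReal.rpow_mul, one_div_mul_cancel (by linarith),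
    ENNReal.rpow_one, integral_eq_lintegral_of_nonneg_ae]
  · exact Eventually.of_forall fun u => Real.rpow_nonneg (abs_nonneg _) _
  · have := ((UU_aemeas hf).sub (UU_aemeas hg)).abs.pow_const p
    exact this.aestronglyMeasurable

/-- Every Borel probability measure on the line is the image of Lebesgue measure on the unit
interval by its (monotone) quantile function. -/
lemma exists_quantile (μ : Measure ℝ) [IsProbabilityMeasure μ] :
    ∃ f : ℝ → ℝ, MonotoneOn f (Set.Ioo (0 : ℝ) 1) ∧ UU.map f = μ := by
  let F := ProbabilityTheory.cdf μ
  have hgal : ∀ u ∈ Set.Ioo (0 : ℝ) 1, ∀ x, sInf {x : ℝ | u ≤ F x} ≤ x ↔ u ≤ F x := by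
    intro u hu x
    have hne : {x : ℝ | u ≤ F x}.Nonempty :=
      (Tendsto.eventually_const_le hu.2 (ProbabilityTheory.tendsto_cdf_atTop μ)).exists
    have hbdd : BddBelow {x : ℝ | u ≤ F x} := by
      obtain ⟨y, hy⟩ := (Tendsto.eventually_lt_const hu.1 (ProbabilityTheory.tendsto_cdf_atBot μ)).exists
      refine ⟨y, fun z hz => ?_⟩
      by_contra hcon
      have : F z ≤ F y := F.mono (not_le.1 hcon).le
      have hz' : u ≤ F z := hz
      have hy' : F y < u := hy
      linarith
    constructor
    · intro h
      have hc : Tendsto F (𝓝[>] x) (𝓝 (F x)) :=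
        (F.right_continuous x).mono_left (nhdsWithin_mono _ Set.Ioi_subset_Ici_self)
      refine ge_of_tendsto hc ?_
      filter_upwards [self_mem_nhdsWithin] with y hy
      obtain ⟨z, hz, hzy⟩ := exists_lt_of_csInf_lt hne (lt_of_le_of_lt h hy)
      exact le_trans hz (F.mono hzy.le)
    · intro h
      exact csInf_le hbdd h
  have hmono : MonotoneOn (fun u => sInf {x : ℝ | u ≤ F x}) (Set.Ioo (0 : ℝ) 1) := by
    intro u hu v hv huv
    show sInf {x : ℝ | u ≤ F x} ≤ sInf {x : ℝ | v ≤ F x}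
    rw [hgal u hu]
    exact huv.trans ((hgal v hv _).1 le_rfl)
  refine ⟨_, hmono, ?_⟩
  have hm := UU_aemeas hmono
  have := Measure.isProbabilityMeasure_map hm
  apply Measure.ext_of_Iic
  intro x
  rw [Measure.map_apply_of_aemeasurable hm measurableSet_Iic, ← ProbabilityTheory.ofReal_cdf]
  have h0 : 0 ≤ F x := ProbabilityTheory.cdf_nonneg μ x
  have h1 : F x ≤ 1 := ProbabilityTheory.cdf_le_one μ x
  have e : UU ((fun u => sInf {x : ℝ | u ≤ F x}) ⁻¹' Set.Iic x) = UU (Set.Iic (F x)) := by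
    apply measure_congr
    filter_upwards [UU_ae_mem] with u hu
    exact propext (hgal u hu x)
  rw [e, UU, Measure.restrict_apply measurableSet_Iic]
  show _ = ENNReal.ofReal (F x)
  apply le_antisymm
  · calc volume (Set.Iic (F x) ∩ Set.Ioo 0 1) ≤ volume (Set.Ioc 0 (F x)) :=
        measure_mono fun u hu => ⟨hu.2.1, hu.1⟩
      _ = _ := by simp
  · calc ENNReal.ofReal (F x) = volume (Set.Ioo 0 (F x)) := by simp
      _ ≤ volume (Set.Iic (F x) ∩ Set.Ioo 0 1) :=
        measure_mono fun u hu => ⟨hu.2.le, hu.1, hu.2.trans_le h1⟩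

/-- The odd power function `y ↦ sign y |y|^(p-1)`. -/
def sp (p y : ℝ) : ℝ := y * |y| ^ (p - 2)

lemma sp_cont (p : ℝ) (hp : 2 ≤ p) : Continuous (sp p) := by
  have : Continuous (fun v : ℝ => |v| ^ (p - 2)) :=
    (Real.continuous_rpow_const (by linarith)).comp continuous_abs
  exact continuous_id.mul this

lemma sp_neg (p y : ℝ) : sp p (-y) = - sp p y := by
  simp [sp]

lemma sp_strictMono (p : ℝ) (hp : 2 ≤ p) : StrictMono (sp p) := by
  apply strictMono_of_odd_strictMonoOn_nonneg (sp_neg p)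
  intro a ha b hb hab
  have ha' : 0 ≤ a := ha
  have hb' : 0 < b := ha'.trans_lt hab
  unfold sp
  rw [abs_of_nonneg ha', abs_of_pos hb']
  calc a * a ^ (p - 2) ≤ a * b ^ (p - 2) :=
        mul_le_mul_of_nonneg_left (Real.rpow_le_rpow ha' hab.le (by linarith)) ha'
    _ < b * b ^ (p - 2) := mul_lt_mul_of_pos_right hab (Real.rpow_pos_of_pos hb' _)

lemma sp_zero (p : ℝ) : sp p 0 = 0 := by simp [sp]

lemma sp_mul (p c y : ℝ) : sp p (c * y) = sp p c * sp p y := by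
  unfold sp
  rw [abs_mul, Real.mul_rpow (abs_nonneg _) (abs_nonneg _)]
  ring

/-- Gradient inequality for `|·|^p`. -/
lemma sp_grad (p : ℝ) (hp : 2 ≤ p) (a b : ℝ) : |b| ^ p + p * sp p b * (a - b) ≤ |a| ^ p := by
  have hp0 : 0 < p := by linarith
  have hconj : (p.HolderConjugate (p / (p - 1))) := by
    have := Real.HolderConjugate.conjExponent (p := p) (by linarith)
    simpa [Real.conjExponent] using this
  have hY := Real.young_inequality a (sp p b) hconj
  have habs : |sp p b| = |b| ^ (p - 1) := by
    unfold sp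
    rw [abs_mul, abs_of_nonneg (Real.rpow_nonneg (abs_nonneg b) _)]
    rcases (abs_nonneg b).eq_or_lt with h | h
    · rw [← h, Real.zero_rpow (by linarith : p - 1 ≠ 0), zero_mul]
    · rw [mul_comm, ← Real.rpow_add_one h.ne']
      congr 1
      ring
  have hpow : |sp p b| ^ (p / (p - 1)) = |b| ^ p := by
    rw [habs, ← Real.rpow_mul (abs_nonneg _)]
    congr 1
    have : p - 1 ≠ 0 := by linarith
    field_simp
  have hbb : sp p b * b = |b| ^ p := by
    unfold sp
    rcases (abs_nonneg b).eq_or_lt with h | h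
    · have hb : b = 0 := abs_eq_zero.1 h.symm
      rw [hb, abs_zero, Real.zero_rpow (by linarith : p ≠ 0)]
      ring
    · have : |b| ^ p = |b| ^ (p - 2) * |b| ^ (2 : ℝ) := by
        rw [← Real.rpow_add h]
        congr 1
        ring
      rw [this, Real.rpow_two, sq_abs]
      ring
  rw [hpow] at hY
  have h3 : p * (a * sp p b) ≤ p * (|a| ^ p / p + |b| ^ p / (p / (p - 1))) :=
    mul_le_mul_of_nonneg_left hY hp0.le
  have h4 : p * (|a| ^ p / p + |b| ^ p / (p / (p - 1))) = |a| ^ p + (p - 1) * |b| ^ p := by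
    have : p - 1 ≠ 0 := by linarith
    field_simp
  have h5 : p * sp p b * (a - b) = p * (a * sp p b) - p * (sp p b * b) := by ring
  rw [h5, hbb]
  linarith

/-- First order condition for the pointwise `p`-mean. -/
def psi (p : ℝ) {n : ℕ} (wt x : Fin n → ℝ) (z : ℝ) : ℝ := ∑ j, wt j * sp p (z - x j)

lemma psi_strictMono (p : ℝ) (hp : 2 ≤ p) {n : ℕ} {wt : Fin n → ℝ} (hw : ∀ j, 0 ≤ wt j)
    {i : Fin n} (hi : 0 < wt i) (x : Fin n → ℝ) : StrictMono (psi p wt x) := by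
  intro a b hab
  refine Finset.sum_lt_sum (fun j _ => ?_) ⟨i, Finset.mem_univ i, ?_⟩
  · exact mul_le_mul_of_nonneg_left ((sp_strictMono p hp).monotone (by linarith)) (hw j)
  · exact mul_lt_mul_of_pos_left (sp_strictMono p hp (by linarith)) hi

lemma psi_exists (p : ℝ) (hp : 2 ≤ p) {n : ℕ} {wt : Fin n → ℝ} (hw : ∀ j, 0 ≤ wt j)
    (x : Fin n → ℝ) : ∃ z, psi p wt x z = 0 := by
  have hcont : Continuous (psi p wt x) := by
    have := sp_cont p hp
    unfold psi
    fun_prop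
  set b := ∑ j, |x j| with hb
  have hxb : ∀ j, |x j| ≤ b := fun j =>
    Finset.single_le_sum (f := fun j => |x j|) (fun k _ => abs_nonneg _) (Finset.mem_univ j)
  have hb0 : 0 ≤ b := Finset.sum_nonneg fun j _ => abs_nonneg _
  have h1 : psi p wt x (-b) ≤ 0 := by
    refine Finset.sum_nonpos fun j _ => mul_nonpos_of_nonneg_of_nonpos (hw j) ?_
    rw [← sp_zero p]
    exact (sp_strictMono p hp).monotone (by linarith [(abs_le.1 (hxb j)).1])
  have h2 : 0 ≤ psi p wt x b := by
    refine Finset.sum_nonneg fun j _ => mul_nonneg (hw j) ?_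
    rw [← sp_zero p]
    exact (sp_strictMono p hp).monotone (by linarith [(abs_le.1 (hxb j)).2])
  obtain ⟨z, _, hz⟩ := intermediate_value_Icc (by linarith : -b ≤ b) hcont.continuousOn ⟨h1, h2⟩
  exact ⟨z, hz⟩

open Classical in
/-- The weighted `p`-mean. -/
def pm (p : ℝ) {n : ℕ} (wt x : Fin n → ℝ) : ℝ :=
  if h : ∃ z, psi p wt x z = 0 then h.choose else 0

lemma pm_spec (p : ℝ) (hp : 2 ≤ p) {n : ℕ} {wt : Fin n → ℝ} (hw : ∀ j, 0 ≤ wt j)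
    (x : Fin n → ℝ) : psi p wt x (pm p wt x) = 0 := by
  have h := psi_exists p hp hw x
  unfold pm
  rw [dif_pos h]
  exact h.choose_spec

lemma pm_mono (p : ℝ) (hp : 2 ≤ p) {n : ℕ} {wt : Fin n → ℝ} (hw : ∀ j, 0 ≤ wt j)
    {i : Fin n} (hi : 0 < wt i) {x y : Fin n → ℝ} (hxy : ∀ j, x j ≤ y j) :
    pm p wt x ≤ pm p wt y := by
  by_contra hcon
  have h1 := psi_strictMono p hp hw hi y (not_le.1 hcon)
  have h2 : psi p wt y (pm p wt x) ≤ psi p wt x (pm p wt x) :=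
    Finset.sum_le_sum fun j _ => mul_le_mul_of_nonneg_left
      ((sp_strictMono p hp).monotone (by linarith [hxy j])) (hw j)
  rw [pm_spec p hp hw] at h1 h2
  linarith

lemma pm_min (p : ℝ) (hp : 2 ≤ p) {n : ℕ} {wt : Fin n → ℝ} (hw : ∀ j, 0 ≤ wt j)
    (x : Fin n → ℝ) (z : ℝ) :
    ∑ j, wt j * |pm p wt x - x j| ^ p ≤ ∑ j, wt j * |z - x j| ^ p := by
  have h := pm_spec p hp hw x
  set m := pm p wt x
  have h2 : ∑ j, wt j * (|m - x j| ^ p + p * sp p (m - x j) * ((z - x j) - (m - x j)))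
      ≤ ∑ j, wt j * |z - x j| ^ p :=
    Finset.sum_le_sum fun j _ => mul_le_mul_of_nonneg_left (sp_grad p hp _ _) (hw j)
  have h3 : ∑ j, wt j * (|m - x j| ^ p + p * sp p (m - x j) * ((z - x j) - (m - x j)))
      = ∑ j, wt j * |m - x j| ^ p + p * (z - m) * psi p wt x m := by
    rw [psi, Finset.mul_sum, ← Finset.sum_add_distrib]
    refine Finset.sum_congr rfl fun j _ => ?_
    ring
  rw [h3, h] at h2
  linarith

lemma pm_le (p : ℝ) (hp : 2 ≤ p) {n : ℕ} {wt : Fin n → ℝ} (hw : ∀ j, 0 ≤ wt j)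
    {i : Fin n} (hi : 0 < wt i) {x : Fin n → ℝ} {b : ℝ} (hb : ∀ j, x j ≤ b) :
    pm p wt x ≤ b := by
  rw [← (psi_strictMono p hp hw hi x).le_iff_le, pm_spec p hp hw]
  refine Finset.sum_nonneg fun j _ => mul_nonneg (hw j) ?_
  rw [← sp_zero p]
  exact (sp_strictMono p hp).monotone (by linarith [hb j])

lemma le_pm (p : ℝ) (hp : 2 ≤ p) {n : ℕ} {wt : Fin n → ℝ} (hw : ∀ j, 0 ≤ wt j)
    {i : Fin n} (hi : 0 < wt i) {x : Fin n → ℝ} {a : ℝ} (ha : ∀ j, a ≤ x j) :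
    a ≤ pm p wt x := by
  rw [← (psi_strictMono p hp hw hi x).le_iff_le, pm_spec p hp hw]
  refine Finset.sum_nonpos fun j _ => mul_nonpos_of_nonneg_of_nonpos (hw j) ?_
  rw [← sp_zero p]
  exact (sp_strictMono p hp).monotone (by linarith [ha j])

/-- Quantitative decrease of the `p`-mean. -/
lemma pm_decr (p : ℝ) (hp : 2 ≤ p) {n : ℕ} {wt : Fin n → ℝ} (hw : ∀ j, 0 ≤ wt j)
    (hs : ∑ j, wt j = 1)
    {ε : ℝ} (hε : 0 < ε) (hε1 : ε ≤ 1) {j : Fin n} (hj : ε ≤ wt j) {x : Fin n → ℝ} {b δ : ℝ}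
    (hδ : 0 ≤ δ) (hb : ∀ k, x k ≤ b) (hxj : x j ≤ b - δ) :
    pm p wt x ≤ b - ε / 2 * δ := by
  rw [← (psi_strictMono p hp hw (hε.trans_le hj) x).le_iff_le, pm_spec p hp hw]
  have hmono := (sp_strictMono p hp).monotone
  have hspδ : 0 ≤ sp p δ := by
    rw [← sp_zero p]
    exact hmono hδ
  have hkey : sp p (ε / 2) ≤ ε * sp p (1 - ε / 2) := by
    unfold sp
    rw [abs_of_pos (by linarith), abs_of_pos (by linarith)]
    have h1 : (ε / 2) ^ (p - 2) ≤ (1 - ε / 2) ^ (p - 2) :=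
      Real.rpow_le_rpow (by linarith) (by linarith) (by linarith)
    have h0 : 0 ≤ (1 - ε / 2) ^ (p - 2) := Real.rpow_nonneg (by linarith) _
    calc ε / 2 * (ε / 2) ^ (p - 2) ≤ ε / 2 * (1 - ε / 2) ^ (p - 2) :=
          mul_le_mul_of_nonneg_left h1 (by linarith)
      _ ≤ (ε * (1 - ε / 2)) * (1 - ε / 2) ^ (p - 2) :=
          mul_le_mul_of_nonneg_right (by nlinarith) h0
      _ = _ := by ring
  have hk0 : 0 ≤ sp p (ε / 2) := by
    rw [← sp_zero p]
    exact hmono (by linarith)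
  have hk1 : 0 ≤ sp p (1 - ε / 2) := by
    rw [← sp_zero p]
    exact hmono (by linarith)
  have hterm : ∀ k, wt k * (- (sp p (ε / 2) * sp p δ)) +
      (if k = j then wt k * (sp p (1 - ε / 2) * sp p δ) else 0)
      ≤ wt k * sp p (b - ε / 2 * δ - x k) := by
    intro k
    have e1 : - (sp p (ε / 2) * sp p δ) = sp p (- (ε / 2 * δ)) := by
      rw [sp_neg, sp_mul]
    by_cases hk : k = j
    · subst hk
      rw [if_pos rfl]
      have h1 : sp p (1 - ε / 2) * sp p δ ≤ sp p (b - ε / 2 * δ - x k) := by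
        rw [← sp_mul]
        exact hmono (by linarith)
      have h2 := mul_le_mul_of_nonneg_left h1 (hw k)
      have h3 := mul_nonneg (hw k) (mul_nonneg hk0 hspδ)
      linarith
    · rw [if_neg hk, add_zero, e1]
      exact mul_le_mul_of_nonneg_left (hmono (by linarith [hb k])) (hw k)
  calc (0 : ℝ) ≤ (ε * sp p (1 - ε / 2) - sp p (ε / 2)) * sp p δ :=
        mul_nonneg (by linarith) hspδ
    _ ≤ ∑ k, (wt k * (- (sp p (ε / 2) * sp p δ)) +
      (if k = j then wt k * (sp p (1 - ε / 2) * sp p δ) else 0)) := by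
        rw [Finset.sum_add_distrib, ← Finset.sum_mul, hs]
        simp only [Finset.sum_ite_eq', Finset.mem_univ, if_true]
        have := mul_le_mul_of_nonneg_right hj (mul_nonneg hk1 hspδ)
        linarith
    _ ≤ _ := Finset.sum_le_sum fun k _ => hterm k

lemma exists_eps {n : ℕ} (hn : 2 ≤ n) (w : Fin n → Fin n → ℝ) (hw : ValidWeights w) :
    ∃ ε : ℝ, 0 < ε ∧ ε ≤ 1 ∧ ∀ i j, 0 < w i j → ε ≤ w i j := by
  classical
  have : Nonempty (Fin n) := ⟨⟨0, by omega⟩⟩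
  obtain ⟨q, _, hq⟩ := Finset.exists_min_image (Finset.univ : Finset (Fin n × Fin n))
    (fun q => if 0 < w q.1 q.2 then w q.1 q.2 else 1) Finset.univ_nonempty
  refine ⟨_, ?_, ?_, fun i j hij => (hq (i, j) (Finset.mem_univ _)).trans ?_⟩
  · split_ifs with h
    · exact h
    · exact one_pos
  · split_ifs with h
    · exact (hw.1 _ _).2
    · exact le_rfl
  · simp [hij]

/-- Scalar nonlinear consensus. -/
lemma consensus (p : ℝ) (hp : 2 ≤ p) (n : ℕ) (hn : 2 ≤ n)
    (w : Fin n → Fin n → ℝ) (hw : ValidWeights w)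
    (hconn : (SimpleGraph.fromRel fun i j : Fin n => 0 < w i j).Connected)
    (x : ℕ → Fin n → ℝ) (hx : ∀ t i, x (t + 1) i = pm p (w i) (x t)) :
    ∃ L, ∀ i, Tendsto (fun t => x t i) atTop (𝓝 L) := by
  have : Nonempty (Fin n) := ⟨⟨0, by omega⟩⟩
  obtain ⟨ε, hε, hε1, hεw⟩ := exists_eps hn w hw
  have hw0 : ∀ i j, 0 ≤ w i j := fun i j => (hw.1 i j).1
  set κ := ε / 2 with hκ
  have hκ0 : 0 < κ := by linarith
  have hκ1 : κ < 1 := by linarith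
  have hup : ∀ t b, (∀ k, x t k ≤ b) → ∀ k, x (t + 1) k ≤ b := by
    intro t b hb k
    rw [hx]
    exact pm_le p hp (hw0 k) (hw.2.2.1 k) hb
  have hdown : ∀ t a, (∀ k, a ≤ x t k) → ∀ k, a ≤ x (t + 1) k := by
    intro t b hb k
    rw [hx]
    exact le_pm p hp (hw0 k) (hw.2.2.1 k) hb
  have hupm : ∀ m t b, (∀ k, x t k ≤ b) → ∀ k, x (t + m) k ≤ b := by
    intro m
    induction m with
    | zero => intro t b hb; exact hb
    | succ m ih => intro t b hb; exact hup _ _ (ih t b hb)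
  have hstep : ∀ t b δ u v, 0 ≤ δ → (∀ k, x t k ≤ b) → x t u ≤ b - δ → 0 < w v u →
      x (t + 1) v ≤ b - κ * δ := by
    intro t b δ u v hδ hb hu hvu
    rw [hx]
    exact pm_decr p hp (hw0 v) (hw.2.2.2 v) hε hε1 (hεw _ _ hvu) hδ hb hu
  have hwalk : ∀ (u v : Fin n) (q : (SimpleGraph.fromRel fun i j : Fin n => 0 < w i j).Walk u v)
      t b δ, 0 ≤ δ → (∀ k, x t k ≤ b) → x t u ≤ b - δ →
      x (t + q.length) v ≤ b - κ ^ q.length * δ := by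
    intro u v q
    induction q with
    | nil => intro t b δ hδ hb hu; simpa using hu
    | cons h q ih =>
      intro t b δ hδ hb hu
      rename_i u u' v
      have hpos : 0 < w u' u := by
        rw [SimpleGraph.fromRel_adj] at h
        rcases h.2 with h | h
        · exact (hw.2.1 _ _).1 h
        · exact h
      have := ih (t + 1) b (κ * δ) (by positivity) (hup t b hb) (hstep t b δ u u' hδ hb hu hpos)
      rw [SimpleGraph.Walk.length_cons, pow_succ, mul_assoc,
        show t + (q.length + 1) = t + 1 + q.length by ring]
      exact this
  have hstay : ∀ m v t b δ, 0 ≤ δ → (∀ k, x t k ≤ b) → x t v ≤ b - δ →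
      x (t + m) v ≤ b - κ ^ m * δ := by
    intro m v
    induction m with
    | zero => intro t b δ hδ hb hu; simpa using hu
    | succ m ih =>
      intro t b δ hδ hb hu
      have := hstep (t + m) b (κ ^ m * δ) v v (by positivity) (hupm m t b hb) (ih t b δ hδ hb hu)
        (hw.2.2.1 v)
      rw [pow_succ', mul_assoc]
      exact this
  have hall : ∀ t b δ u, 0 ≤ δ → (∀ k, x t k ≤ b) → x t u ≤ b - δ →
      ∀ v, x (t + n) v ≤ b - κ ^ n * δ := by
    intro t b δ u hδ hb hu v
    obtain ⟨q, hq⟩ := hconn.preconnected.exists_isPath u v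
    have hlen := hq.length_lt
    rw [Fintype.card_fin] at hlen
    have h1 := hwalk u v q t b δ hδ hb hu
    have h2 := hstay (n - q.length) v (t + q.length) b _ (by positivity) (hupm _ t b hb) h1
    rw [← mul_assoc, ← pow_add, show n - q.length + q.length = n by omega,
      show t + q.length + (n - q.length) = t + n by omega] at h2
    exact h2
  let B : ℕ → ℝ := fun t => Finset.univ.sup' Finset.univ_nonempty (x t)
  let A : ℕ → ℝ := fun t => Finset.univ.inf' Finset.univ_nonempty (x t)
  have hB : ∀ t k, x t k ≤ B t := fun t k => Finset.le_sup' (x t) (Finset.mem_univ k)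
  have hA : ∀ t k, A t ≤ x t k := fun t k => Finset.inf'_le (x t) (Finset.mem_univ k)
  have hBle : ∀ t b, (∀ k, x t k ≤ b) → B t ≤ b := fun t b h => Finset.sup'_le _ _ fun k _ => h k
  have hleA : ∀ t a, (∀ k, a ≤ x t k) → a ≤ A t := fun t b h => Finset.le_inf' _ _ fun k _ => h k
  have hBanti : Antitone B := antitone_nat_of_succ_le fun t => hBle _ _ (hup t _ (hB t))
  have hAmono : Monotone A := monotone_nat_of_le_succ fun t => hleA _ _ (hdown t _ (hA t))
  have hAB : ∀ t, A t ≤ B t := fun t => (hA t (Classical.arbitrary _)).trans (hB t _)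
  have hBconv : Tendsto B atTop (𝓝 (⨅ t, B t)) :=
    tendsto_atTop_ciInf hBanti ⟨A 0, by rintro _ ⟨t, rfl⟩; exact (hAmono (Nat.zero_le t)).trans (hAB t)⟩
  have hAconv : Tendsto A atTop (𝓝 (⨆ t, A t)) :=
    tendsto_atTop_ciSup hAmono ⟨B 0, by rintro _ ⟨t, rfl⟩; exact (hAB t).trans (hBanti (Nat.zero_le t))⟩
  set β := ⨅ t, B t
  set α := ⨆ t, A t
  have hcontr : ∀ t, B (t + n) ≤ B t - κ ^ n * (B t - A t) := by
    intro t
    obtain ⟨u, _, hu⟩ := Finset.exists_mem_eq_inf' Finset.univ_nonempty (x t)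
    apply hBle
    refine hall t (B t) (B t - A t) u (by linarith [hAB t]) (hB t) ?_
    have : A t = x t u := hu
    linarith
  have hlim : β ≤ β - κ ^ n * (β - α) :=
    le_of_tendsto_of_tendsto' (hBconv.comp (tendsto_add_atTop_nat n))
      (hBconv.sub ((hBconv.sub hAconv).const_mul (κ ^ n))) hcontr
  have hαβ : α ≤ β := le_of_tendsto_of_tendsto' hAconv hBconv hAB
  have hκn : 0 < κ ^ n := by positivity
  have heq : α = β := by
    apply le_antisymm hαβ
    by_contra hcon
    have := mul_pos hκn (sub_pos.2 (not_le.1 hcon))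
    linarith
  refine ⟨β, fun i => ?_⟩
  exact tendsto_of_tendsto_of_tendsto_of_le_of_le (heq ▸ hAconv) hBconv (fun t => hA t i)
    (fun t => hB t i)

lemma memUp_iff (p : ℝ) (hp : 2 ≤ p) {f : ℝ → ℝ} (hf : MonotoneOn f (Set.Ioo (0 : ℝ) 1)) :
    MemUp p (UU.map f) ↔ MemLp f (ENNReal.ofReal p) UU := by
  have hfm := UU_aemeas hf
  have hp0 : ENNReal.ofReal p ≠ 0 := by
    simp only [ne_eq, ENNReal.ofReal_eq_zero, not_le]
    linarith
  have hprob : IsProbabilityMeasure (UU.map f) := Measure.isProbabilityMeasure_map hfm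
  have hlint : ∫⁻ x : ℝ, ENNReal.ofReal (|x| ^ p) ∂(UU.map f) = ∫⁻ u, ‖f u‖ₑ ^ p ∂UU := by
    rw [lintegral_map' (by fun_prop) hfm]
    refine lintegral_congr fun u => ?_
    rw [Real.enorm_eq_ofReal_abs, ENNReal.ofReal_rpow_of_nonneg (abs_nonneg _) (by linarith)]
  have hL := eLpNorm_lt_top_iff_lintegral_rpow_enorm_lt_top (f := f) (μ := UU) hp0
    ENNReal.ofReal_ne_top
  rw [ENNReal.toReal_ofReal (by linarith)] at hL
  constructor
  · intro h
    refine ⟨hfm.aestronglyMeasurable, hL.2 ?_⟩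
    rw [← hlint]
    exact h.2
  · intro h
    refine ⟨hprob, ?_⟩
    rw [hlint]
    exact hL.1 h.2

lemma integrable_pow (p : ℝ) (hp : 2 ≤ p) {f : ℝ → ℝ} (hf : MemLp f (ENNReal.ofReal p) UU) :
    Integrable (fun u => |f u| ^ p) UU := by
  have hp0 : ENNReal.ofReal p ≠ 0 := by
    simp only [ne_eq, ENNReal.ofReal_eq_zero, not_le]
    linarith
  have := hf.integrable_norm_rpow hp0 ENNReal.ofReal_ne_top
  rw [ENNReal.toReal_ofReal (by linarith)] at this
  exact this

/-- The pointwise `p`-mean of quantile functions represents a Wasserstein barycenter. -/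
lemma pm_isBarycenter (p : ℝ) (hp : 2 ≤ p) {n : ℕ} {wt : Fin n → ℝ} (hw : ∀ j, 0 ≤ wt j)
    (f : Fin n → ℝ → ℝ) (hf : ∀ j, MonotoneOn (f j) (Set.Ioo (0 : ℝ) 1))
    (hfL : ∀ j, MemLp (f j) (ENNReal.ofReal p) UU)
    (hm : MonotoneOn (fun u => pm p wt fun j => f j u) (Set.Ioo (0 : ℝ) 1))
    (hmL : MemLp (fun u => pm p wt fun j => f j u) (ENNReal.ofReal p) UU) :
    IsBarycenter p wt (fun j => UU.map (f j)) (UU.map fun u => pm p wt fun j => f j u) := by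
  refine ⟨(memUp_iff p hp hm).2 hmL, fun χ hχ => ?_⟩
  have := hχ.1
  obtain ⟨g, hg, rfl⟩ := exists_quantile χ
  have hgL := (memUp_iff p hp hg).1 hχ
  have hi1 : ∀ j ∈ (Finset.univ : Finset (Fin n)),
      Integrable (fun u => wt j * |(pm p wt fun j => f j u) - f j u| ^ p) UU := fun j _ =>
    (integrable_pow p hp (hmL.sub (hfL j))).const_mul _
  have hi2 : ∀ j ∈ (Finset.univ : Finset (Fin n)),
      Integrable (fun u => wt j * |g u - f j u| ^ p) UU := fun j _ =>
    (integrable_pow p hp (hgL.sub (hfL j))).const_mul _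
  simp_rw [fun j => Wp_pow p hp hm (hf j), fun j => Wp_pow p hp hg (hf j), ← integral_const_mul]
  rw [← integral_finsetSum _ hi1, ← integral_finsetSum _ hi2]
  exact integral_mono (integrable_finsetSum _ hi1) (integrable_finsetSum _ hi2)
    fun u => pm_min p hp hw _ _

/-- Evolution of the quantile functions. -/
def fevo (p : ℝ) {n : ℕ} (w : Fin n → Fin n → ℝ) (f0 : Fin n → ℝ → ℝ) : ℕ → Fin n → ℝ → ℝ
  | 0 => f0
  | t + 1 => fun i u => pm p (w i) fun j => fevo p w f0 t j u

/-- Over a time-invariant connected undirected network, the Wasserstein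
consensus protocol drives all agents' measures to a common limit `μ* ∈ 𝒰_p(ℝ)` in `ℓ_p`. -/
theorem wasserstein_consensus_time_invariant
    (p : ℝ) (hp : 2 ≤ p) (n : ℕ) (hn : 2 ≤ n)
    (w : Fin n → Fin n → ℝ) (hw : ValidWeights w)
    (hconn : (SimpleGraph.fromRel fun i j : Fin n => 0 < w i j).Connected)
    (μ : ℕ → Fin n → Measure ℝ)
    (h0 : ∀ i, MemUp p (μ 0 i))
    (hupdate : ∀ t, ConsensusStep p w (μ t) (μ (t + 1))) :
    ∃ μstar : Measure ℝ, MemUp p μstar ∧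
      ∀ i, Tendsto (fun t => Wp p (μ t i) μstar) atTop (𝓝 0) := by
  have hw0 : ∀ i j, 0 ≤ w i j := fun i j => (hw.1 i j).1
  have hwi : ∀ i, 0 < w i i := hw.2.2.1
  have hq : ∀ i, ∃ f : ℝ → ℝ, MonotoneOn f (Set.Ioo (0 : ℝ) 1) ∧ UU.map f = μ 0 i := by
    intro i
    have := (h0 i).1
    exact exists_quantile (μ 0 i)
  choose f0 hf0m hf0 using hq
  set f := fevo p w f0 with hf
  have hfs : ∀ t i u, f (t + 1) i u = pm p (w i) fun j => f t j u := fun t i u => rfl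
  have hmono : ∀ t i, MonotoneOn (f t i) (Set.Ioo (0 : ℝ) 1) := by
    intro t
    induction t with
    | zero => exact hf0m
    | succ t ih =>
      intro i u hu v hv huv
      rw [hfs, hfs]
      exact pm_mono p hp (hw0 i) (hwi i) fun j => ih j hu hv huv
  set G : ℝ → ℝ := fun u => ∑ j, |f0 j u| with hG
  have hbound : ∀ t i u, |f t i u| ≤ G u := by
    intro t
    induction t with
    | zero =>
      intro i u
      exact Finset.single_le_sum (f := fun j => |f0 j u|) (fun k _ => abs_nonneg _)
        (Finset.mem_univ i)
    | succ t ih =>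
      intro i u
      rw [hfs, abs_le]
      exact ⟨le_pm p hp (hw0 i) (hwi i) fun j => (abs_le.1 (ih j u)).1,
        pm_le p hp (hw0 i) (hwi i) fun j => (abs_le.1 (ih j u)).2⟩
  have hf0L : ∀ i, MemLp (f0 i) (ENNReal.ofReal p) UU := by
    intro i
    rw [← memUp_iff p hp (hf0m i), hf0 i]
    exact h0 i
  have hGL : MemLp G (ENNReal.ofReal p) UU :=
    memLp_finsetSum _ fun j _ => (hf0L j).norm
  have hG0 : ∀ u, 0 ≤ G u := fun u => Finset.sum_nonneg fun j _ => abs_nonneg _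
  have hfL : ∀ t i, MemLp (f t i) (ENNReal.ofReal p) UU := by
    intro t i
    refine hGL.mono (UU_aemeas (hmono t i)).aestronglyMeasurable (Eventually.of_forall fun u => ?_)
    rw [Real.norm_eq_abs, Real.norm_eq_abs, abs_of_nonneg (hG0 u)]
    exact hbound t i u
  have hμ : ∀ t i, μ t i = UU.map (f t i) := by
    intro t
    induction t with
    | zero => exact fun i => (hf0 i).symm
    | succ t ih =>
      intro i
      have hb := pm_isBarycenter p hp (hw0 i) (f t) (hmono t) (hfL t) (hmono (t + 1) i)
        (hfL (t + 1) i)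
      rw [← funext ih] at hb
      exact ((hupdate t i).2 _ hb).symm
  have hcons : ∀ u, ∃ L, ∀ i, Tendsto (fun t => f t i u) atTop (𝓝 L) := fun u =>
    consensus p hp n hn w hw hconn (fun t i => f t i u) fun t i => hfs t i u
  choose L hL using hcons
  have i0 : Fin n := ⟨0, by omega⟩
  have hLm : MonotoneOn L (Set.Ioo (0 : ℝ) 1) := fun u hu v hv huv =>
    le_of_tendsto_of_tendsto' (hL u i0) (hL v i0) fun t => hmono t i0 hu hv huv
  have hLb : ∀ u, |L u| ≤ G u := fun u =>
    le_of_tendsto' (hL u i0).abs fun t => hbound t i0 u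
  have hLL : MemLp L (ENNReal.ofReal p) UU := by
    refine hGL.mono (UU_aemeas hLm).aestronglyMeasurable (Eventually.of_forall fun u => ?_)
    rw [Real.norm_eq_abs, Real.norm_eq_abs, abs_of_nonneg (hG0 u)]
    exact hLb u
  refine ⟨UU.map L, (memUp_iff p hp hLm).2 hLL, fun i => ?_⟩
  have hW : ∀ t, Wp p (μ t i) (UU.map L) =
      ((∫⁻ u, ENNReal.ofReal (|f t i u - L u| ^ p) ∂UU) ^ (1 / p)).toReal := by
    intro t
    rw [hμ t i, Wp_eq_s8 p hp (hmono t i) hLm]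
  simp_rw [hW]
  have hdc : Tendsto (fun t => ∫⁻ u, ENNReal.ofReal (|f t i u - L u| ^ p) ∂UU) atTop
      (𝓝 (∫⁻ _u, 0 ∂UU)) := by
    refine tendsto_lintegral_of_dominated_convergence'
      (fun u => ENNReal.ofReal (|(G + G) u| ^ p)) (fun t => ?_) (fun t => ?_) ?_ ?_
    · exact (((UU_aemeas (hmono t i)).sub (UU_aemeas hLm)).abs.pow_const p).ennreal_ofReal
    · refine Eventually.of_forall fun u => ENNReal.ofReal_le_ofReal ?_
      refine Real.rpow_le_rpow (abs_nonneg _) ?_ (by linarith)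
      rw [Pi.add_apply, abs_of_nonneg (a := G u + G u) (by linarith [hG0 u])]
      exact (abs_sub _ _).trans (add_le_add (hbound t i u) (hLb u))
    · exact (integrable_pow p hp (hGL.add hGL)).lintegral_lt_top.ne
    · refine Eventually.of_forall fun u => ?_
      have h1 : Tendsto (fun t => |f t i u - L u|) atTop (𝓝 0) := by
        simpa using ((hL u i).sub_const (L u)).abs
      have h2 := h1.rpow_const (p := p) (Or.inr (by linarith))
      rw [Real.zero_rpow (by linarith)] at h2
      simpa using ENNReal.tendsto_ofReal h2
  rw [lintegral_zero] at hdc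
  have h3 := hdc.ennrpow_const (1 / p)
  rw [ENNReal.zero_rpow_of_pos (by positivity)] at h3
  simpa [Function.comp_def] using (ENNReal.tendsto_toReal ENNReal.zero_ne_top).comp h3

end
end

section
/- Let μ_1,…,μ_k ∈ 𝒰_2(ℝ) be Gaussian measures, μ_j = 𝒩(p_j, P_j) with mean p_j ∈ ℝ and variance P_j > 0, and let w_1,…,w_k > 0 with Σ_j w_j = 1. Then the minimizer over η ∈ 𝒰_2(ℝ) of Σ_j w_j ℓ_2(η, μ_j)² is the Gaussian measure 𝒩(q, Q) with mean q = Σ_j w_j p_j and variance Q = (Σ_j w_j P_j^{1/2})². -/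
open MeasureTheory Filter Topology

noncomputable section

/-- Finite second moment gives square integrability. -/
lemma gb_memLp {μ : Measure ℝ} (h : MemUp 2 μ) : MemLp (fun x : ℝ => x) 2 μ := by
  rw [memLp_two_iff_integrable_sq (by fun_prop)]
  refine ⟨by fun_prop, ?_⟩
  rw [hasFiniteIntegral_iff_ofReal (Eventually.of_forall fun x => sq_nonneg x)]
  refine lt_of_le_of_lt (le_of_eq ?_) h.2
  refine lintegral_congr fun x => ?_
  rw [Real.rpow_two, sq_abs]

lemma gb_memUp {μ : Measure ℝ} [IsProbabilityMeasure μ] (h : MemLp (fun x : ℝ => x) 2 μ) :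
    MemUp 2 μ := by
  refine ⟨inferInstance, ?_⟩
  rw [memLp_two_iff_integrable_sq (by fun_prop)] at h
  have h2 := h.2
  rw [hasFiniteIntegral_iff_ofReal (Eventually.of_forall fun x => sq_nonneg x)] at h2
  refine lt_of_le_of_lt (le_of_eq ?_) h2
  refine lintegral_congr fun x => ?_
  rw [Real.rpow_two, sq_abs]

lemma gb_fst {χ ν : Measure ℝ} {γ : Measure (ℝ × ℝ)} (hγ : γ ∈ Couplings χ ν)
    (h : MemUp 2 χ) : MemLp (fun z : ℝ × ℝ => z.1) 2 γ := by
  have := gb_memLp h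
  rw [← hγ.2.1] at this
  exact (memLp_map_measure_iff (g := fun x : ℝ => x) (f := (Prod.fst : ℝ × ℝ → ℝ))
    (by fun_prop) (by fun_prop)).1 this

lemma gb_snd {χ ν : Measure ℝ} {γ : Measure (ℝ × ℝ)} (hγ : γ ∈ Couplings χ ν)
    (h : MemUp 2 ν) : MemLp (fun z : ℝ × ℝ => z.2) 2 γ := by
  have := gb_memLp h
  rw [← hγ.2.2] at this
  exact (memLp_map_measure_iff (g := fun x : ℝ => x) (f := (Prod.snd : ℝ × ℝ → ℝ))
    (by fun_prop) (by fun_prop)).1 this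

lemma gb_cost {χ ν : Measure ℝ} {γ : Measure (ℝ × ℝ)} (hγ : γ ∈ Couplings χ ν)
    (h : MemUp 2 χ) (h' : MemUp 2 ν) :
    ∫⁻ z : ℝ × ℝ, ENNReal.ofReal (|z.1 - z.2| ^ (2 : ℝ)) ∂γ
      = ENNReal.ofReal (∫ z : ℝ × ℝ, (z.1 - z.2) ^ 2 ∂γ) := by
  have hd : MemLp (fun z : ℝ × ℝ => z.1 - z.2) 2 γ := (gb_fst hγ h).sub (gb_snd hγ h')
  rw [ofReal_integral_eq_lintegral_ofReal hd.integrable_sq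
    (Eventually.of_forall fun x => sq_nonneg _)]
  refine lintegral_congr fun x => ?_
  rw [Real.rpow_two, sq_abs]

lemma gb_prod {χ ν : Measure ℝ} (h : MemUp 2 χ) (h' : MemUp 2 ν) :
    χ.prod ν ∈ Couplings χ ν := by
  have := h.1
  have := h'.1
  refine ⟨inferInstance, ?_, ?_⟩
  · simpa using Measure.map_fst_prod (μ := χ) (ν := ν)
  · simpa using Measure.map_snd_prod (μ := χ) (ν := ν)

lemma gb_inf_ne_top {χ ν : Measure ℝ} (h : MemUp 2 χ) (h' : MemUp 2 ν) :
    (⨅ γ ∈ Couplings χ ν, ∫⁻ z : ℝ × ℝ, ENNReal.ofReal (|z.1 - z.2| ^ (2 : ℝ)) ∂γ) ≠ ⊤ := by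
  have h1 := iInf₂_le (f := fun (γ : Measure (ℝ × ℝ)) (_ : γ ∈ Couplings χ ν) =>
    ∫⁻ z : ℝ × ℝ, ENNReal.ofReal (|z.1 - z.2| ^ (2 : ℝ)) ∂γ) _ (gb_prod h h')
  refine ne_top_of_le_ne_top ?_ h1
  rw [gb_cost (gb_prod h h') h h']
  exact ENNReal.ofReal_ne_top

lemma gb_Wp_sq (χ ν : Measure ℝ) :
    Wp 2 χ ν ^ (2 : ℝ) =
    (⨅ γ ∈ Couplings χ ν, ∫⁻ z : ℝ × ℝ, ENNReal.ofReal (|z.1 - z.2| ^ (2 : ℝ)) ∂γ).toReal := by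
  unfold Wp
  rw [ENNReal.toReal_rpow, ← ENNReal.rpow_mul]
  norm_num

lemma gb_Wp_le {χ ν : Measure ℝ} {γ : Measure (ℝ × ℝ)} (hγ : γ ∈ Couplings χ ν)
    (h : MemUp 2 χ) (h' : MemUp 2 ν) :
    Wp 2 χ ν ^ (2 : ℝ) ≤ ∫ z : ℝ × ℝ, (z.1 - z.2) ^ 2 ∂γ := by
  rw [gb_Wp_sq]
  refine ENNReal.toReal_le_of_le_ofReal (integral_nonneg fun _ => sq_nonneg _) ?_
  rw [← gb_cost hγ h h']
  exact iInf₂_le γ hγ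

lemma gb_Wp_approx {χ ν : Measure ℝ} (h : MemUp 2 χ) (h' : MemUp 2 ν) {ε : ℝ} (hε : 0 < ε) :
    ∃ γ ∈ Couplings χ ν, ∫ z : ℝ × ℝ, (z.1 - z.2) ^ 2 ∂γ < Wp 2 χ ν ^ (2 : ℝ) + ε := by
  have hlt : (⨅ γ ∈ Couplings χ ν, ∫⁻ z : ℝ × ℝ, ENNReal.ofReal (|z.1 - z.2| ^ (2 : ℝ)) ∂γ)
      < ENNReal.ofReal (Wp 2 χ ν ^ (2 : ℝ) + ε) := by
    rw [ENNReal.lt_ofReal_iff_toReal_lt (gb_inf_ne_top h h'), ← gb_Wp_sq]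
    linarith
  simp only [iInf_lt_iff] at hlt
  obtain ⟨γ, hγ, hl⟩ := hlt
  refine ⟨γ, hγ, ?_⟩
  rw [gb_cost hγ h h'] at hl
  exact (ENNReal.ofReal_lt_ofReal_iff_of_nonneg (integral_nonneg fun _ => sq_nonneg _)).1 hl

/-- The dual lower bound for the transport cost to `𝒩(p, P)`. -/
def gbG (q p P a : ℝ) (χ : Measure ℝ) : ℝ :=
  (1 - a) * ∫ x, (x - q) ^ 2 ∂χ + 2 * (q - p) * ∫ x, (x - q) ∂χ
    + ((1 - a⁻¹) * P + (q - p) ^ 2)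

lemma gb_gauss_memUp (p : ℝ) (P : NNReal) : MemUp 2 (ProbabilityTheory.gaussianReal p P) :=
  gb_memUp (ProbabilityTheory.memLp_id_gaussianReal' 2 (by simp))

lemma gb_gauss_var (p : ℝ) (P : NNReal) :
    ∫ y, (y - p) ^ 2 ∂(ProbabilityTheory.gaussianReal p P) = P := by
  have := ProbabilityTheory.variance_fun_id_gaussianReal (μ := p) (v := P)
  rw [ProbabilityTheory.variance_eq_integral (by fun_prop)] at this
  simpa using this

lemma gb_gauss_mean (p : ℝ) (P : NNReal) :
    ∫ y, (y - p) ∂(ProbabilityTheory.gaussianReal p P) = 0 := by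
  rw [integral_sub ((gb_memLp (gb_gauss_memUp p P)).integrable (by norm_num))
    (integrable_const _)]
  simp

lemma gb_identity {χ : Measure ℝ} {γ : Measure (ℝ × ℝ)} {q p a : ℝ} {P : NNReal} (ha : 0 < a)
    (h : MemUp 2 χ) (hγ : γ ∈ Couplings χ (ProbabilityTheory.gaussianReal p P)) :
    ∫ z : ℝ × ℝ, (z.1 - z.2) ^ 2 ∂γ =
      gbG q p P a χ + a⁻¹ * ∫ z : ℝ × ℝ, (a * (z.1 - q) - (z.2 - p)) ^ 2 ∂γ := by
  have := hγ.1
  have hG := gb_gauss_memUp p P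
  have h1 : MemLp (fun z : ℝ × ℝ => z.1 - q) 2 γ := (gb_fst hγ h).sub (memLp_const q)
  have h2 : MemLp (fun z : ℝ × ℝ => z.2 - p) 2 γ := (gb_snd hγ hG).sub (memLp_const p)
  have h3 : MemLp (fun z : ℝ × ℝ => a * (z.1 - q) - (z.2 - p)) 2 γ := (h1.const_mul a).sub h2
  have i1 : Integrable (fun z : ℝ × ℝ => z.1 - q) γ := h1.integrable (by norm_num)
  have i2 : Integrable (fun z : ℝ × ℝ => z.2 - p) γ := h2.integrable (by norm_num)
  have e1 : ∫ x, (x - q) ^ 2 ∂χ = ∫ z : ℝ × ℝ, (z.1 - q) ^ 2 ∂γ := by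
    rw [← hγ.2.1, integral_map (by fun_prop) (by fun_prop)]
  have e2 : ∫ x, (x - q) ∂χ = ∫ z : ℝ × ℝ, (z.1 - q) ∂γ := by
    rw [← hγ.2.1, integral_map (by fun_prop) (by fun_prop)]
  have e3 : (P : ℝ) = ∫ z : ℝ × ℝ, (z.2 - p) ^ 2 ∂γ := by
    rw [← gb_gauss_var p P, ← hγ.2.2, integral_map (by fun_prop) (by fun_prop)]
  have e4 : 0 = ∫ z : ℝ × ℝ, (z.2 - p) ∂γ := by
    rw [← gb_gauss_mean p P, ← hγ.2.2, integral_map (by fun_prop) (by fun_prop)]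
  have e5 : ∀ z : ℝ × ℝ, (z.1 - z.2) ^ 2 =
      ((((1 - a) * (z.1 - q) ^ 2 + 2 * (q - p) * (z.1 - q)) + (1 - a⁻¹) * (z.2 - p) ^ 2)
        + (-2 * (q - p)) * (z.2 - p)) + (q - p) ^ 2
        + a⁻¹ * (a * (z.1 - q) - (z.2 - p)) ^ 2 := by
    intro z
    field_simp
    ring
  have j1 := h1.integrable_sq.const_mul (1 - a)
  have j2 := i1.const_mul (2 * (q - p))
  have j3 := h2.integrable_sq.const_mul (1 - a⁻¹)
  have j4 := i2.const_mul (-2 * (q - p))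
  have j5 : Integrable (fun _ : ℝ × ℝ => (q - p) ^ 2) γ := integrable_const _
  have j6 := h3.integrable_sq.const_mul a⁻¹
  have j12 := j1.fun_add j2
  have j13 := j12.fun_add j3
  have j14 := j13.fun_add j4
  have j15 := j14.fun_add j5
  simp_rw [e5]
  rw [integral_add j15 j6, integral_add j14 j5, integral_add j13 j4, integral_add j12 j3,
    integral_add j1 j2]
  simp only [integral_const_mul]
  rw [← e4, ← e3, ← e2, ← e1]
  simp only [gbG, integral_const, probReal_univ, one_smul]
  ring

lemma gb_lower {χ : Measure ℝ} {q p a : ℝ} {P : NNReal} (ha : 0 < a) (h : MemUp 2 χ) :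
    gbG q p P a χ ≤ Wp 2 χ (ProbabilityTheory.gaussianReal p P) ^ (2 : ℝ) := by
  refine le_of_forall_pos_lt_add fun ε hε => ?_
  obtain ⟨γ, hγ, hl⟩ := gb_Wp_approx h (gb_gauss_memUp p P) hε
  rw [gb_identity (q := q) ha h hγ] at hl
  have : 0 ≤ a⁻¹ * ∫ z : ℝ × ℝ, (a * (z.1 - q) - (z.2 - p)) ^ 2 ∂γ :=
    mul_nonneg (inv_nonneg.2 ha.le) (integral_nonneg fun _ => sq_nonneg _)
  linarith

lemma gb_affine (q p a : ℝ) (Q P : NNReal) (haP : (P : ℝ) = a ^ 2 * Q) :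
    (ProbabilityTheory.gaussianReal q Q).map (fun x => a * (x - q) + p)
      = ProbabilityTheory.gaussianReal p P := by
  have e : (fun x : ℝ => a * (x - q) + p) = (fun x => x + p) ∘ (fun x => a * x) ∘ (fun x => x - q) :=
    rfl
  rw [e, ← Measure.map_map (by fun_prop) (by fun_prop), ← Measure.map_map (by fun_prop) (by fun_prop),
    ProbabilityTheory.gaussianReal_map_sub_const, ProbabilityTheory.gaussianReal_map_const_mul,
    ProbabilityTheory.gaussianReal_map_add_const]
  congr 1
  · ring
  · exact NNReal.eq (by simp [haP])

lemma gb_upper {q p a : ℝ} {Q P : NNReal} (ha : 0 < a) (haP : (P : ℝ) = a ^ 2 * Q) :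
    Wp 2 (ProbabilityTheory.gaussianReal q Q) (ProbabilityTheory.gaussianReal p P) ^ (2 : ℝ)
      ≤ gbG q p P a (ProbabilityTheory.gaussianReal q Q) := by
  set γ := (ProbabilityTheory.gaussianReal q Q).map (fun x => (x, a * (x - q) + p)) with hγd
  have hγ : γ ∈ Couplings (ProbabilityTheory.gaussianReal q Q)
      (ProbabilityTheory.gaussianReal p P) := by
    refine ⟨Measure.isProbabilityMeasure_map (by fun_prop), ?_, ?_⟩
    · rw [hγd, Measure.map_map (by fun_prop) (by fun_prop)]
      exact Measure.map_id
    · rw [hγd, Measure.map_map (by fun_prop) (by fun_prop)]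
      exact gb_affine q p a Q P haP
  refine (gb_Wp_le hγ (gb_gauss_memUp _ _) (gb_gauss_memUp _ _)).trans ?_
  rw [gb_identity (q := q) ha (gb_gauss_memUp _ _) hγ, hγd,
    integral_map (by fun_prop) (by fun_prop)]
  simp

lemma gb_unique {χ : Measure ℝ} {q p a : ℝ} {Q P : NNReal} (ha : 0 < a)
    (haP : (P : ℝ) = a ^ 2 * Q) (h : MemUp 2 χ)
    (hle : Wp 2 χ (ProbabilityTheory.gaussianReal p P) ^ (2 : ℝ) ≤ gbG q p P a χ) :
    χ = ProbabilityTheory.gaussianReal q Q := by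
  have := h.1
  have key : χ.map (fun x => a * (x - q) + p) = ProbabilityTheory.gaussianReal p P := by
    have : IsProbabilityMeasure (χ.map (fun x => a * (x - q) + p)) :=
      Measure.isProbabilityMeasure_map (by fun_prop)
    apply Measure.ext_of_charFun
    ext t
    rw [← sub_eq_zero, ← norm_le_zero_iff]
    refine le_of_forall_pos_le_add fun ε hε => ?_
    set δ : ℝ := ε / (2 * (|t| + 1)) with hδd
    have hδ : 0 < δ := by positivity
    obtain ⟨γ, hγ, hl⟩ := gb_Wp_approx h (gb_gauss_memUp p P) (ε := a⁻¹ * δ ^ 2) (by positivity)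
    rw [gb_identity (q := q) ha h hγ] at hl
    have hD : ∫ z : ℝ × ℝ, (a * (z.1 - q) - (z.2 - p)) ^ 2 ∂γ ≤ δ ^ 2 := by
      have : a⁻¹ * ∫ z : ℝ × ℝ, (a * (z.1 - q) - (z.2 - p)) ^ 2 ∂γ < a⁻¹ * δ ^ 2 := by linarith
      exact (lt_of_mul_lt_mul_left this (inv_nonneg.2 ha.le)).le
    have := hγ.1
    have h1 : MemLp (fun z : ℝ × ℝ => z.1 - q) 2 γ := (gb_fst hγ h).sub (memLp_const q)
    have h2 : MemLp (fun z : ℝ × ℝ => z.2 - p) 2 γ :=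
      (gb_snd hγ (gb_gauss_memUp p P)).sub (memLp_const p)
    have h3 : MemLp (fun z : ℝ × ℝ => a * (z.1 - q) - (z.2 - p)) 2 γ := (h1.const_mul a).sub h2
    have c1 : charFun (χ.map (fun x => a * (x - q) + p)) t
        = ∫ z : ℝ × ℝ, Complex.exp (((t * (a * (z.1 - q) + p) : ℝ) : ℂ) * Complex.I) ∂γ := by
      rw [charFun_apply_real, integral_map (by fun_prop) (by fun_prop), ← hγ.2.1,
        integral_map (by fun_prop) (by fun_prop)]
      simp
    have c2 : charFun (ProbabilityTheory.gaussianReal p P) t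
        = ∫ z : ℝ × ℝ, Complex.exp (((t * z.2 : ℝ) : ℂ) * Complex.I) ∂γ := by
      rw [charFun_apply_real, ← hγ.2.2, integral_map (by fun_prop) (by fun_prop)]
      simp
    have ic : ∀ f : ℝ × ℝ → ℝ, Measurable f →
        Integrable (fun z => Complex.exp (((f z : ℝ) : ℂ) * Complex.I)) γ := by
      intro f hf
      refine Integrable.of_bound (C := 1) (by fun_prop) (Eventually.of_forall fun z => ?_)
      rw [Complex.norm_exp_ofReal_mul_I]
    rw [c1, c2, ← integral_sub (ic _ (by fun_prop)) (ic _ (by fun_prop))]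
    have bd : ∀ z : ℝ × ℝ, ‖Complex.exp (((t * (a * (z.1 - q) + p) : ℝ) : ℂ) * Complex.I)
        - Complex.exp (((t * z.2 : ℝ) : ℂ) * Complex.I)‖
        ≤ |t| * (δ + δ⁻¹ * (a * (z.1 - q) - (z.2 - p)) ^ 2) := by
      intro z
      set D := a * (z.1 - q) - (z.2 - p) with hDd
      have e : Complex.exp (((t * (a * (z.1 - q) + p) : ℝ) : ℂ) * Complex.I)
        - Complex.exp (((t * z.2 : ℝ) : ℂ) * Complex.I)
        = Complex.exp (((t * z.2 : ℝ) : ℂ) * Complex.I) *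
          (Complex.exp (Complex.I * ((t * D : ℝ) : ℂ)) - 1) := by
        rw [mul_sub (Complex.exp _), ← Complex.exp_add, mul_one, hDd]
        congr 2
        push_cast
        ring
      rw [e, norm_mul, Complex.norm_exp_ofReal_mul_I, one_mul]
      refine Real.norm_exp_I_mul_ofReal_sub_one_le.trans ?_
      rw [Real.norm_eq_abs, abs_mul]
      refine mul_le_mul_of_nonneg_left ?_ (abs_nonneg t)
      have : δ * |D| ≤ δ * (δ + δ⁻¹ * D ^ 2) := by
        rw [mul_add, ← mul_assoc, mul_inv_cancel₀ hδ.ne', one_mul, ← sq_abs D]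
        nlinarith [sq_nonneg (δ - |D|), sq_nonneg δ, sq_nonneg |D|]
      exact le_of_mul_le_mul_left this hδ
    have ib : Integrable (fun z : ℝ × ℝ => δ⁻¹ * (a * (z.1 - q) - (z.2 - p)) ^ 2) γ :=
      h3.integrable_sq.const_mul δ⁻¹
    refine (norm_integral_le_of_norm_le (((integrable_const δ).fun_add ib).const_mul |t|)
      (Eventually.of_forall bd)).trans ?_
    rw [integral_const_mul, integral_add (integrable_const δ) ib, integral_const_mul]
    simp only [integral_const, probReal_univ, one_smul]
    have : δ⁻¹ * ∫ z : ℝ × ℝ, (a * (z.1 - q) - (z.2 - p)) ^ 2 ∂γ ≤ δ := by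
      rw [inv_mul_le_iff₀ hδ]
      linarith
    have hεδ : ε = 2 * (|t| + 1) * δ := by
      rw [hδd]
      field_simp
    calc |t| * (δ + δ⁻¹ * ∫ z : ℝ × ℝ, (a * (z.1 - q) - (z.2 - p)) ^ 2 ∂γ)
        ≤ |t| * (δ + δ) := mul_le_mul_of_nonneg_left (by linarith) (abs_nonneg t)
      _ ≤ 0 + ε := by rw [hεδ]; nlinarith
  have key2 := congrArg (fun m => m.map (fun x => a⁻¹ * (x - p) + q)) key
  rw [gb_affine p q a⁻¹ P Q (by rw [haP]; field_simp),
    Measure.map_map (by fun_prop) (by fun_prop)] at key2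
  have e : ((fun x => a⁻¹ * (x - p) + q) ∘ fun x : ℝ => a * (x - q) + p) = id := by
    ext x
    simp [ha.ne']
  rw [e, Measure.map_id] at key2
  exact key2

/-- The `2`-Wasserstein barycenter of scalar Gaussians `𝒩(p_j, P_j)` with
positive weights `w_j` summing to one is the Gaussian with mean `∑_j w_j p_j` and variance
`(∑_j w_j P_j^{1/2})²`. -/
theorem gaussian_barycenter_scalar
    (k : ℕ) (pj : Fin k → ℝ) (P : Fin k → NNReal) (hP : ∀ j, 0 < P j)
    (w : Fin k → NNReal) (hw : ∀ j, 0 < w j) (hsum : ∑ j, w j = 1) :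
    IsBarycenter 2 (fun j => (w j : ℝ))
        (fun j => ProbabilityTheory.gaussianReal (pj j) (P j))
        (ProbabilityTheory.gaussianReal (∑ j, (w j : ℝ) * pj j)
          ((∑ j, w j * NNReal.sqrt (P j)) ^ 2)) ∧
      ∀ η : Measure ℝ,
        IsBarycenter 2 (fun j => (w j : ℝ))
            (fun j => ProbabilityTheory.gaussianReal (pj j) (P j)) η →
          η = ProbabilityTheory.gaussianReal (∑ j, (w j : ℝ) * pj j)
                ((∑ j, w j * NNReal.sqrt (P j)) ^ 2) := by
  set q : ℝ := ∑ j, (w j : ℝ) * pj j with hq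
  set s : NNReal := ∑ j, w j * NNReal.sqrt (P j) with hs
  have hne : (Finset.univ : Finset (Fin k)).Nonempty := by
    rw [Finset.nonempty_iff_ne_empty]
    intro h0
    rw [h0] at hsum
    simp at hsum
  have hs0 : 0 < s := Finset.sum_pos
    (fun j _ => mul_pos (hw j) (NNReal.sqrt_pos.2 (hP j))) hne
  have hsR : (0 : ℝ) < s := hs0
  have hsumR : ∑ j, (w j : ℝ) = 1 := by exact_mod_cast hsum
  let a : Fin k → ℝ := fun j => (NNReal.sqrt (P j) : ℝ) / s
  have ha : ∀ j, 0 < a j := fun j =>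
    div_pos (NNReal.coe_pos.2 (NNReal.sqrt_pos.2 (hP j))) hsR
  have haP : ∀ j, (P j : ℝ) = a j ^ 2 * ((s ^ 2 : NNReal) : ℝ) := by
    intro j
    have : (NNReal.sqrt (P j) : ℝ) ^ 2 = P j := by exact_mod_cast NNReal.sq_sqrt (P j)
    simp only [a, NNReal.coe_pow]
    rw [div_pow, this]
    field_simp
  have hwa : ∑ j, (w j : ℝ) * (1 - a j) = 0 := by
    have : ∑ j, (w j : ℝ) * a j = 1 := by
      simp only [a, ← mul_div_assoc]
      rw [← Finset.sum_div, div_eq_one_iff_eq hsR.ne', hs]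
      push_cast
      rfl
    simp only [mul_sub, mul_one, Finset.sum_sub_distrib, this, hsumR, sub_self]
  have hwq : ∑ j, (w j : ℝ) * (2 * (q - pj j)) = 0 := by
    have : ∀ j, (w j : ℝ) * (2 * (q - pj j)) = 2 * ((w j : ℝ) * q - w j * pj j) := by
      intro j; ring
    simp only [this]
    rw [← Finset.mul_sum, Finset.sum_sub_distrib, ← Finset.sum_mul, hsumR, ← hq]
    ring
  have hconst : ∀ χ : Measure ℝ, ∑ j, (w j : ℝ) * gbG q (pj j) (P j) (a j) χ =
      ∑ j, (w j : ℝ) * ((1 - (a j)⁻¹) * P j + (q - pj j) ^ 2) := by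
    intro χ
    simp only [gbG, mul_add, Finset.sum_add_distrib, ← mul_assoc]
    simp only [← Finset.sum_mul]
    simp only [← mul_assoc] at hwq
    rw [hwa, hwq]
    ring
  have hup : ∑ j, (w j : ℝ) * Wp 2 (ProbabilityTheory.gaussianReal q (s ^ 2))
        (ProbabilityTheory.gaussianReal (pj j) (P j)) ^ (2 : ℝ) ≤
      ∑ j, (w j : ℝ) * ((1 - (a j)⁻¹) * P j + (q - pj j) ^ 2) := by
    rw [← hconst (ProbabilityTheory.gaussianReal q (s ^ 2))]
    exact Finset.sum_le_sum fun j _ =>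
      mul_le_mul_of_nonneg_left (gb_upper (ha j) (haP j)) (w j).2
  have hlow : ∀ χ : Measure ℝ, MemUp 2 χ → ∀ j, (w j : ℝ) * gbG q (pj j) (P j) (a j) χ ≤
      (w j : ℝ) * Wp 2 χ (ProbabilityTheory.gaussianReal (pj j) (P j)) ^ (2 : ℝ) :=
    fun χ hχ j => mul_le_mul_of_nonneg_left (gb_lower (ha j) hχ) (w j).2
  refine ⟨⟨gb_gauss_memUp _ _, fun χ hχ => ?_⟩, fun η hη => ?_⟩
  · refine hup.trans ?_
    rw [← hconst χ]
    exact Finset.sum_le_sum fun j _ => hlow χ hχ j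
  · have h1 := hη.2 _ (gb_gauss_memUp q (s ^ 2))
    have h2 := h1.trans hup
    rw [← hconst η] at h2
    have h3 := (Finset.sum_eq_sum_iff_of_le (fun j _ => hlow η hη.1 j)).1
      (le_antisymm (Finset.sum_le_sum fun j _ => hlow η hη.1 j) h2)
    obtain ⟨j, hj⟩ := hne
    have h4 := mul_left_cancel₀ (NNReal.coe_pos.2 (hw j)).ne' (h3 j hj)
    exact gb_unique (ha j) (haP j) hη.1 h4.ge

end
end
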